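/- arXiv:1608.01597 — 2 statements merged into one kernel-verified Lean document; each statement's English description precedes it below -/
import Mathlib

section
/- Let θ be a real number and k ≥ 1 an integer. For a three-times continuously differentiable function f : ℝ^k → ℝ define, at every point z ∈ ℝ^k with pairwise distinct coordinates, (B₁f)(z) := Σ_{i=1}^k ∂f/∂z_i(z), (B₂f)(z) := (1/2) Σ_{i=1}^k z_i ∂²f/∂z_i²(z) + θ Σ_{i=1}^k Σ_{j≠i} (z_i/(z_i−z_j)) ∂f/∂z_i(z), and (A^{(k)}f)(z) := (1/2) Σ_{i=1}^k ∂²f/∂z_i²(z) + θ Σ_{i=1}^k Σ_{j≠i} (1/(z_i−z_j)) ∂f/∂z_i(z). Then for every z ∈ ℝ^k with pairwise distinct coordinates, (B₁(B₂f))(z) − (B₂(B₁f))(z) = (A^{(k)}f)(z); that is, A^{(k)} equals the commutator B₁B₂ − B₂B₁ on the open set of points with pairwise distinct coordinates. -/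
open Finset

/-- First-order partial derivative `∂f/∂z_i (z)`. -/
noncomputable def pd {m : ℕ} (f : (Fin m → ℝ) → ℝ) (i : Fin m) (z : Fin m → ℝ) : ℝ :=
  fderiv ℝ f z (Pi.single i 1)

/-- Second-order partial derivative `∂²f/∂z_i² (z)`. -/
noncomputable def pd2 {m : ℕ} (f : (Fin m → ℝ) → ℝ) (i : Fin m) (z : Fin m → ℝ) : ℝ :=
  fderiv ℝ (fun w => fderiv ℝ f w (Pi.single i 1)) z (Pi.single i 1)

/-- The generator `A^{(m)}` of the `m`-dimensional `β`-Dyson Brownian motion, `θ = β/2`. -/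
noncomputable def genA {m : ℕ} (θ : ℝ) (f : (Fin m → ℝ) → ℝ) (z : Fin m → ℝ) : ℝ :=
  (1 / 2) * ∑ i, pd2 f i z +
    θ * ∑ i, ∑ j ∈ univ.erase i, (1 / (z i - z j)) * pd f i z

/-- The operator `B₁ = Σ_i ∂/∂z_i`. -/
noncomputable def opB1 {m : ℕ} (f : (Fin m → ℝ) → ℝ) (z : Fin m → ℝ) : ℝ :=
  ∑ i, pd f i z

/-- The operator `B₂ = (1/2) Σ_i z_i ∂²/∂z_i² + θ Σ_i Σ_{j≠i} (z_i/(z_i-z_j)) ∂/∂z_i`. -/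
noncomputable def opB2 {m : ℕ} (θ : ℝ) (f : (Fin m → ℝ) → ℝ) (z : Fin m → ℝ) : ℝ :=
  (1 / 2) * ∑ i, z i * pd2 f i z +
    θ * ∑ i, ∑ j ∈ univ.erase i, (z i / (z i - z j)) * pd f i z

theorem aux_comm {k : ℕ} (f : (Fin k → ℝ) → ℝ) (hf : ContDiff ℝ 2 f) (u v z : Fin k → ℝ) :
    fderiv ℝ (fun w => fderiv ℝ f w u) z v = fderiv ℝ (fun w => fderiv ℝ f w v) z u := by
  have hd : DifferentiableAt ℝ (fderiv ℝ f) z :=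
    ((hf.fderiv_right (m := 1) (by norm_num)).differentiable (by norm_num)) z
  have h := (hf.contDiffAt (x := z)).isSymmSndFDerivAt (by simp)
  have e : ∀ a b : Fin k → ℝ, fderiv ℝ (fun w => fderiv ℝ f w a) z b
      = fderiv ℝ (fderiv ℝ f) z b a := by
    intro a b
    rw [fderiv_clm_apply hd (differentiableAt_const a)]
    simp
  rw [e, e]
  exact h v u

theorem aux_contDiff {k : ℕ} {n m : WithTop ℕ∞} (f : (Fin k → ℝ) → ℝ) (hf : ContDiff ℝ n f)
    (h : m + 1 ≤ n) (u : Fin k → ℝ) : ContDiff ℝ m (fun w => fderiv ℝ f w u) :=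
  (hf.fderiv_right h).clm_apply contDiff_const

theorem aux_B1 {k : ℕ} (g : (Fin k → ℝ) → ℝ) :
    opB1 g = fun z => fderiv ℝ g z (fun _ => 1) := by
  funext z
  unfold opB1 pd
  rw [← map_sum]
  congr 1
  exact Finset.univ_sum_single (fun _ => (1 : ℝ))

/-- On the open set of points with pairwise distinct coordinates, the generator of the
`β`-Dyson Brownian motion equals the commutator `B₁ B₂ - B₂ B₁`. -/
theorem commutator_eq_dyson_generator (θ : ℝ) (k : ℕ) (hk : 1 ≤ k)
    (f : (Fin k → ℝ) → ℝ) (hf : ContDiff ℝ 3 f)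
    (z : Fin k → ℝ) (hz : Function.Injective z) :
    opB1 (opB2 θ f) z - opB2 θ (opB1 f) z = genA θ f z := by
  have h2 : ContDiff ℝ 2 f := hf.of_le (by norm_num)
  have p1 : ∀ i, ContDiff ℝ 2 (pd f i) := fun i =>
    aux_contDiff f hf (by norm_num) _
  have p2 : ∀ i, ContDiff ℝ 1 (pd2 f i) := fun i =>
    aux_contDiff (pd f i) (p1 i) (by norm_num) _
  have c1 : ∀ i w, pd (opB1 f) i w = fderiv ℝ (pd f i) w (fun _ => 1) := by
    intro i w
    rw [aux_B1]
    exact aux_comm f h2 _ _ _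
  have c2 : ∀ i w, pd2 (opB1 f) i w = fderiv ℝ (pd2 f i) w (fun _ => 1) := by
    intro i w
    have : pd (opB1 f) i = fun w => fderiv ℝ (pd f i) w (fun _ => 1) := funext (c1 i)
    change fderiv ℝ (pd (opB1 f) i) w (Pi.single i 1) = _
    rw [this]
    exact aux_comm (pd f i) (p1 i) _ _ _
  have d0 : ∀ i, HasFDerivAt (fun w : Fin k → ℝ => w i)
      (ContinuousLinearMap.proj (R := ℝ) (φ := fun _ : Fin k => ℝ) i) z := fun i =>
    hasFDerivAt_apply i z
  have d1 : ∀ i, HasFDerivAt (pd f i) (fderiv ℝ (pd f i) z) z := fun i =>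
    ((p1 i).differentiable (by norm_num) z).hasFDerivAt
  have d2 : ∀ i, HasFDerivAt (pd2 f i) (fderiv ℝ (pd2 f i) z) z := fun i =>
    ((p2 i).differentiable (by norm_num) z).hasFDerivAt
  have hne : ∀ i, ∀ j ∈ univ.erase i, z i - z j ≠ 0 := by
    intro i j hj h
    exact (Finset.ne_of_mem_erase hj) (hz (sub_eq_zero.mp h)).symm
  have d3 : ∀ i, ∀ j ∈ univ.erase i, HasFDerivAt (fun w : Fin k → ℝ => w i / (w i - w j))
      (z i • ((-((z i - z j) ^ 2)⁻¹) • (ContinuousLinearMap.proj (R := ℝ)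
        (φ := fun _ : Fin k => ℝ) i - ContinuousLinearMap.proj j)) +
        (z i - z j)⁻¹ • ContinuousLinearMap.proj i) z := by
    intro i j hj
    have h := (hasDerivAt_inv (hne i j hj)).comp_hasFDerivAt z ((d0 i).fun_sub (d0 j))
    simp only [div_eq_mul_inv]
    exact (d0 i).fun_mul h
  have hA := HasFDerivAt.fun_sum (u := univ) (fun i _ => (d0 i).fun_mul (d2 i))
  have hB := HasFDerivAt.fun_sum (u := univ) (fun i _ =>
    HasFDerivAt.fun_sum (u := univ.erase i) (fun j hj =>
      (d3 i j hj).fun_mul (d1 i)))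
  have hT := (hA.const_mul (1 / 2)).fun_add (hB.const_mul θ)
  have hT' : HasFDerivAt (opB2 θ f) _ z := hT
  rw [aux_B1 (opB2 θ f)]
  beta_reduce
  rw [hT'.fderiv]
  unfold opB2 genA
  simp only [c1, c2]
  simp only [ContinuousLinearMap.add_apply, ContinuousLinearMap.smul_apply,
    ContinuousLinearMap.sum_apply, ContinuousLinearMap.sub_apply,
    ContinuousLinearMap.proj_apply, smul_eq_mul]
  rw [add_sub_add_comm, ← mul_sub, ← mul_sub, ← Finset.sum_sub_distrib, ← Finset.sum_sub_distrib]
  congr 2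
  · exact Finset.sum_congr rfl fun i _ => by ring
  · refine Finset.sum_congr rfl fun i _ => ?_
    rw [← Finset.sum_sub_distrib]
    refine Finset.sum_congr rfl fun j hj => ?_
    have := hne i j hj
    field_simp
    ring
end

section
/- Fix β > 0, set θ = β/2, and let k ≥ 1. Let p be a symmetric polynomial in k real variables. Then there exists a symmetric polynomial q in k+1 real variables such that: (i) for every strictly increasing x = (x_1 < x_2 < … < x_{k+1}) ∈ ℝ^{k+1}, q(x) = ∫_{W^{(k)}(x)} Λ^{(k)}(x,y) p(y) dy; and (ii) for every such x, (A^{(k+1)}q)(x) = ∫_{W^{(k)}(x)} Λ^{(k)}(x,y) (A^{(k)}p)(y) dy, where (A^{(k)}p)(y) is defined for Lebesgue-almost every y in W^{(k)}(x) (namely at all y with pairwise distinct coordinates). In other words, the Dixon–Anderson kernel intertwines the generators A^{(k)} and A^{(k+1)} of the β-Dyson Brownian motions on symmetric polynomials. -/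
open Finset MeasureTheory

/-- The interlacing domain `W^{(k)}(x) = {y : x_1 ≤ y_1 ≤ x_2 ≤ y_2 ≤ … ≤ y_k ≤ x_{k+1}}`. -/
def DAdomain (k : ℕ) (x : Fin (k + 1) → ℝ) : Set (Fin k → ℝ) :=
  {y | ∀ i : Fin k, x i.castSucc ≤ y i ∧ y i ≤ x i.succ}

/-- The Dixon–Anderson conditional probability density `Λ^{(k)}(x,y)` with parameter `β`. -/
noncomputable def DAdensity (k : ℕ) (β : ℝ) (x : Fin (k + 1) → ℝ) (y : Fin k → ℝ) : ℝ :=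
  (Real.Gamma (β * (k + 1) / 2) / Real.Gamma (β / 2) ^ (k + 1)) *
    (∏ i : Fin (k + 1), ∏ j ∈ Ioi i, (x j - x i) ^ (1 - β)) *
    (∏ i : Fin k, ∏ j ∈ Ioi i, (y j - y i)) *
    (∏ i : Fin k, ∏ j : Fin (k + 1), |y i - x j| ^ (β / 2 - 1))


/-- The weights. -/
noncomputable def daw {k : ℕ} (x : Fin (k + 1) → ℝ) (y : Fin k → ℝ) (j : Fin (k + 1)) : ℝ :=
  ∏ i : Fin k, ((x j - y i) / (x j - x (j.succAbove i)))

/-- open interlacing domain -/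
def DAint (k : ℕ) (x : Fin (k + 1) → ℝ) : Set (Fin k → ℝ) :=
  {y | ∀ i : Fin k, x i.castSucc < y i ∧ y i < x i.succ}

lemma da_lagr {k : ℕ} (x : Fin (k + 1) → ℝ) (hx : Function.Injective x) (y : Fin k → ℝ) :
    (∏ i, (Polynomial.X - Polynomial.C (y i)) : Polynomial ℝ) =
      ∑ j, Polynomial.C (daw x y j) *
        ∏ i, (Polynomial.X - Polynomial.C (x (j.succAbove i))) := by
  have hd : ∀ z : Fin k → ℝ,
      (∏ i, (Polynomial.X - Polynomial.C (z i)) : Polynomial ℝ).degree < ((k + 1 : ℕ) : WithBot ℕ) := by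
    intro z
    rw [Polynomial.degree_prod]
    simp only [Polynomial.degree_X_sub_C, sum_const, card_univ, Fintype.card_fin]
    simp
    exact_mod_cast Nat.lt_succ_self k
  refine Polynomial.eq_of_degrees_lt_of_eval_index_eq (s := univ) (v := x) hx.injOn ?_ ?_ ?_
  · simpa using hd y
  · refine (Polynomial.degree_sum_le _ _).trans_lt ?_
    rw [Finset.sup_lt_iff]
    · intro j _
      rw [Polynomial.C_mul']
      refine lt_of_le_of_lt (Polynomial.degree_smul_le _ _) ?_
      simpa using hd (fun i => x (j.succAbove i))
    · exact WithBot.bot_lt_coe _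
  · intro j _
    rw [Polynomial.eval_finsetSum, Finset.sum_eq_single j]
    · simp only [Polynomial.eval_prod, Polynomial.eval_mul, Polynomial.eval_sub,
        Polynomial.eval_X, Polynomial.eval_C]
      rw [daw, ← Finset.prod_mul_distrib]
      refine Finset.prod_congr rfl fun i _ => ?_
      have : x j - x (j.succAbove i) ≠ 0 := sub_ne_zero.2 fun h => (Fin.succAbove_ne j i) (hx h).symm
      field_simp
    · intro l _ hl
      obtain ⟨i, hi⟩ := Fin.exists_succAbove_eq hl.symm
      simp only [Polynomial.eval_prod, Polynomial.eval_mul, Polynomial.eval_sub,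
        Polynomial.eval_X, Polynomial.eval_C]
      rw [Finset.prod_eq_zero (mem_univ i), mul_zero]
      rw [hi, sub_self]
    · simp

lemma da_lagr_eval {k : ℕ} (x : Fin (k + 1) → ℝ) (hx : Function.Injective x) (y : Fin k → ℝ)
    (t : ℝ) : ∏ i, (t - y i) = ∑ j, daw x y j * ∏ i, (t - x (j.succAbove i)) := by
  have := congrArg (Polynomial.eval t) (da_lagr x hx y)
  simpa [Polynomial.eval_prod, Polynomial.eval_finsetSum] using this

lemma da_coeff {k : ℕ} (z : Fin k → ℝ) :
    (∏ i, (Polynomial.X - Polynomial.C (z i)) : Polynomial ℝ).coeff k = 1 := by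
  have h := Polynomial.monic_prod_X_sub_C z univ
  have h2 : (∏ i, (Polynomial.X - Polynomial.C (z i)) : Polynomial ℝ).natDegree = k := by
    rw [Polynomial.natDegree_prod _ _ (fun i _ => Polynomial.X_sub_C_ne_zero _)]
    simp
  have := h.coeff_natDegree
  rwa [h2] at this

lemma daw_sum {k : ℕ} (x : Fin (k + 1) → ℝ) (hx : Function.Injective x) (y : Fin k → ℝ) :
    ∑ j, daw x y j = 1 := by
  have := congrArg (fun p => Polynomial.coeff p k) (da_lagr x hx y)
  simp only [Polynomial.finsetSum_coeff, Polynomial.coeff_C_mul] at this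
  rw [da_coeff] at this
  rw [this]
  refine Finset.sum_congr rfl fun j _ => ?_
  rw [da_coeff, mul_one]

lemma da_cases {k : ℕ} {x : Fin (k + 1) → ℝ} (hx : StrictMono x) {y : Fin k → ℝ}
    (hy : y ∈ DAint k x) (j : Fin (k + 1)) (i : Fin k) :
    0 < (x j - y i) / (x j - x (j.succAbove i)) := by
  by_cases h : i.castSucc < j
  · rw [Fin.succAbove_of_castSucc_lt _ _ h]
    have h1 : x i.castSucc < x j := hx h
    have h2 : x i.succ ≤ x j := hx.monotone (by rwa [Fin.castSucc_lt_iff_succ_le] at h)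
    have := hy i
    exact div_pos (by linarith) (by linarith)
  · push Not at h
    rw [Fin.succAbove_of_le_castSucc _ _ h]
    have h1 : x j ≤ x i.castSucc := hx.monotone h
    have := hy i
    exact div_pos_of_neg_of_neg (by linarith) (by linarith)

lemma daw_pos {k : ℕ} {x : Fin (k + 1) → ℝ} (hx : StrictMono x) {y : Fin k → ℝ}
    (hy : y ∈ DAint k x) (j : Fin (k + 1)) : 0 < daw x y j :=
  Finset.prod_pos fun i _ => da_cases hx hy j i

lemma da_ne {k : ℕ} {x : Fin (k + 1) → ℝ} (hx : StrictMono x) {y : Fin k → ℝ}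
    (hy : y ∈ DAint k x) (j : Fin (k + 1)) (i : Fin k) : x j - y i ≠ 0 := by
  intro h
  have := da_cases hx hy j i
  rw [h] at this
  simp at this

lemma da_y_strict {k : ℕ} {x : Fin (k + 1) → ℝ} (hx : StrictMono x) {y : Fin k → ℝ}
    (hy : y ∈ DAint k x) : StrictMono y := by
  intro a b hab
  have h1 := (hy a).2
  have h2 := (hy b).1
  have : x a.succ ≤ x b.castSucc := hx.monotone (by
    rw [Fin.le_def]; simp; exact hab)
  linarith

/-- polynomial equality determines the data -/
lemma da_poly_ext {k : ℕ} (x : Fin (k + 1) → ℝ) (hx : Function.Injective x)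
    {p q : Polynomial ℝ} (hp : p.degree < ((k + 1 : ℕ) : WithBot ℕ))
    (hq : q.degree < ((k + 1 : ℕ) : WithBot ℕ)) (h : ∀ j, p.eval (x j) = q.eval (x j)) : p = q :=
  Polynomial.eq_of_degrees_lt_of_eval_index_eq (s := univ) (v := x) hx.injOn
    (by simpa using hp) (by simpa using hq) (fun j _ => h j)


/-- Vandermonde product -/
noncomputable def vdm {n : ℕ} (v : Fin n → ℝ) : ℝ := ∏ i : Fin n, ∏ j ∈ Ioi i, (v j - v i)

lemma vdm_pos {n : ℕ} {v : Fin n → ℝ} (hv : StrictMono v) : 0 < vdm v :=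
  Finset.prod_pos fun _ _ => Finset.prod_pos fun _ hj => sub_pos.2 (hv (mem_Ioi.1 hj))

/-- product over all ordered pairs of distinct entries -/
lemma abs_prod_succAbove {n : ℕ} (v : Fin (n + 1) → ℝ) (f : ℝ → ℝ) (hf : ∀ a, f (-a) = f a) :
    ∏ j, ∏ i, f (v j - v (j.succAbove i)) =
      (∏ i : Fin (n + 1), ∏ j ∈ Ioi i, f (v j - v i)) ^ 2 := by
  have h1 : ∀ j, ∏ i, f (v j - v (j.succAbove i)) =
      (∏ l ∈ Ioi j, f (v l - v j)) * ∏ l ∈ Iio j, f (v j - v l) := by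
    intro j
    have : ∏ i, f (v j - v (j.succAbove i)) = ∏ l ∈ univ.erase j, f (v j - v l) := by
      have hE : univ.erase j = univ.map (Fin.succAboveEmb j) := by
        ext l
        simp only [mem_erase, mem_univ, and_true, mem_map, true_and]
        exact Fin.exists_succAbove_eq_iff.symm
      rw [hE, Finset.prod_map]
      rfl
    rw [this]
    have hU : univ.erase j = Ioi j ∪ Iio j := by
      ext l
      simp only [mem_erase, mem_univ, and_true, mem_union, mem_Ioi, mem_Iio]
      rw [ne_iff_lt_or_gt, or_comm]
    have hdis : Disjoint (Ioi j) (Iio j) := by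
      rw [Finset.disjoint_left]
      intro a ha hb
      exact lt_asymm (mem_Ioi.1 ha) (mem_Iio.1 hb)
    rw [hU, Finset.prod_union hdis]
    congr 1
    refine Finset.prod_congr rfl fun l _ => ?_
    rw [← hf, neg_sub]
  rw [Finset.prod_congr rfl fun j _ => h1 j, Finset.prod_mul_distrib, sq]
  congr 1
  exact Finset.prod_comm' (by simp)

lemma prod_succAbove_sq {n : ℕ} (v : Fin (n + 1) → ℝ) :
    ∏ j, ∏ i, |v j - v (j.succAbove i)| = |vdm v| ^ 2 := by
  rw [abs_prod_succAbove v (fun a => |a|) (fun a => abs_neg a), vdm]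
  simp only [Finset.abs_prod]

/-- the polynomials -/
noncomputable def dapoly {k : ℕ} (y : Fin k → ℝ) : Fin (k + 1) → Polynomial ℝ :=
  Fin.cons (∏ l, (Polynomial.X - Polynomial.C (y l)))
    (fun i => ∏ l ∈ univ.erase i, (Polynomial.X - Polynomial.C (y l)))

lemma dapoly_deg {k : ℕ} (y : Fin k → ℝ) (c : Fin (k + 1)) : (dapoly y c).natDegree < k + 1 := by
  refine Fin.cases ?_ (fun i => ?_) c
  · simp only [dapoly, Fin.cons_zero]
    rw [Polynomial.natDegree_prod _ _ (fun i _ => Polynomial.X_sub_C_ne_zero _)]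
    simp
  · simp only [dapoly, Fin.cons_succ]
    rw [Polynomial.natDegree_prod _ _ (fun i _ => Polynomial.X_sub_C_ne_zero _)]
    simp

noncomputable def dacoef {k : ℕ} (y : Fin k → ℝ) : Matrix (Fin (k + 1)) (Fin (k + 1)) ℝ :=
  Matrix.of fun m c => (dapoly y c).coeff m

lemma daeval {k : ℕ} (y : Fin k → ℝ) (v : Fin (k + 1) → ℝ) :
    (Matrix.of fun j c => (dapoly y c).eval (v j)) = Matrix.vandermonde v * dacoef y := by
  ext j c
  rw [Matrix.mul_apply]
  simp only [Matrix.of_apply, Matrix.vandermonde_apply, dacoef]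
  rw [Polynomial.eval_eq_sum_range' (dapoly_deg y c), Finset.sum_range]
  exact Finset.sum_congr rfl fun m _ => mul_comm _ _

lemma vdm_cons {k : ℕ} (z : ℝ) (y : Fin k → ℝ) :
    vdm (Fin.cons z y : Fin (k + 1) → ℝ) = (∏ i, (y i - z)) * vdm y := by
  rw [vdm, Fin.prod_univ_succ]
  congr 1
  · rw [Fin.prod_Ioi_zero]; simp
  · rw [vdm]
    refine Finset.prod_congr rfl fun i _ => ?_
    rw [Fin.prod_Ioi_succ]
    simp

lemma vdm_erase {n : ℕ} (v : Fin n → ℝ) :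
    ∏ j, ∏ l ∈ univ.erase j, |v j - v l| = |vdm v| ^ 2 := by
  cases n with
  | zero => simp [vdm]
  | succ n =>
    rw [← prod_succAbove_sq]
    refine Finset.prod_congr rfl fun j _ => ?_
    have hE : univ.erase j = univ.map (Fin.succAboveEmb j) := by
      ext l
      simp only [mem_erase, mem_univ, and_true, mem_map, true_and]
      exact Fin.exists_succAbove_eq_iff.symm
    rw [hE, Finset.prod_map]
    rfl

lemma dacoef_det {k : ℕ} {y : Fin k → ℝ} (hy : StrictMono y) (z : ℝ) (hz : ∀ i, z - y i ≠ 0) :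
    |(dacoef y).det| = vdm y := by
  have h := congrArg Matrix.det (daeval y (Fin.cons z y))
  rw [Matrix.det_mul, Matrix.det_vandermonde] at h
  have htri : Matrix.BlockTriangular
      (Matrix.of fun j c => (dapoly y c).eval ((Fin.cons z y : Fin (k + 1) → ℝ) j)) id := by
    intro a b hab
    simp only [id] at hab
    revert hab
    refine Fin.cases ?_ (fun m => ?_) a
    · intro h; simp at h
    · intro hab
      simp only [Matrix.of_apply, Fin.cons_succ]
      revert hab
      refine Fin.cases ?_ (fun i => ?_) b
      · intro _
        simp only [dapoly, Fin.cons_zero, Polynomial.eval_prod]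
        exact Finset.prod_eq_zero (mem_univ m) (by simp)
      · intro hab
        have : i ≠ m := by rintro rfl; exact lt_irrefl _ hab
        simp only [dapoly, Fin.cons_succ, Polynomial.eval_prod]
        exact Finset.prod_eq_zero (i := m) (by simp [this.symm]) (by simp)
  rw [Matrix.det_of_isUpperTriangular htri, Fin.prod_univ_succ] at h
  have hv : ∏ i : Fin (k + 1), ∏ j ∈ Ioi i, ((Fin.cons z y : Fin (k + 1) → ℝ) j -
      (Fin.cons z y : Fin (k + 1) → ℝ) i) = (∏ i, (y i - z)) * vdm y := vdm_cons z y
  rw [hv] at h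
  simp only [Matrix.of_apply, Fin.cons_zero, Fin.cons_succ, dapoly, Polynomial.eval_prod,
    Polynomial.eval_sub, Polynomial.eval_X, Polynomial.eval_C] at h
  have h2 := congrArg abs h
  simp only [abs_mul, Finset.abs_prod] at h2
  rw [vdm_erase, ← Finset.abs_prod, ← Finset.abs_prod] at h2
  have e1 : |∏ i, (y i - z)| = |∏ i, (z - y i)| := by
    simp only [Finset.abs_prod]
    exact Finset.prod_congr rfl fun i _ => abs_sub_comm _ _
  rw [e1] at h2
  have h3 : |∏ i, (z - y i)| ≠ 0 := abs_ne_zero.2 (Finset.prod_ne_zero_iff.2 fun i _ => hz i)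
  have h4 := vdm_pos hy
  rw [abs_of_pos h4] at h2
  have h5 : |∏ i, (z - y i)| * vdm y * vdm y = |∏ i, (z - y i)| * vdm y * |(dacoef y).det| := by
    linarith [h2]
  exact (mul_left_cancel₀ (mul_ne_zero h3 h4.ne') h5).symm

/-- Jacobian matrix -/
noncomputable def daM {k : ℕ} (x : Fin (k + 1) → ℝ) (z : Fin (k + 1) → ℝ) :
    Matrix (Fin (k + 1)) (Fin (k + 1)) ℝ :=
  Matrix.of fun j => Fin.cons (daw x (Fin.tail z) j)
    (fun i => - z 0 * daw x (Fin.tail z) j / (x j - Fin.tail z i))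

lemma daM_det {k : ℕ} {x : Fin (k + 1) → ℝ} (hx : StrictMono x) (z : Fin (k + 1) → ℝ)
    (hz : 0 < z 0) (hy : Fin.tail z ∈ DAint k x) :
    |(daM x z).det| = z 0 ^ k * vdm (Fin.tail z) / vdm x := by
  set y := Fin.tail z with hyd
  have hM : daM x z = Matrix.of fun j c =>
      (∏ i, (x j - x (j.succAbove i)))⁻¹ *
      ((Matrix.of fun j c => (Fin.cons 1 (fun _ => - z 0) : Fin (k + 1) → ℝ) c *
        (Matrix.of fun j c => (dapoly y c).eval (x j)) j c) j c) := by
    ext j c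
    simp only [daM, Matrix.of_apply, ← hyd]
    refine Fin.cases ?_ (fun i => ?_) c
    · simp only [Fin.cons_zero, dapoly, Polynomial.eval_prod, daw, Finset.prod_div_distrib]
      simp
      ring
    · simp only [Fin.cons_succ, dapoly, Polynomial.eval_prod, daw, Finset.prod_div_distrib]
      rw [← Finset.mul_prod_erase _ _ (mem_univ i)]
      have := da_ne hx hy j i
      simp
      field_simp
  rw [hM, Matrix.det_mul_column, Matrix.det_mul_row, daeval, Matrix.det_mul, Matrix.det_vandermonde]
  rw [Fin.prod_univ_succ (fun c => (Fin.cons 1 (fun _ => - z 0) : Fin (k + 1) → ℝ) c)]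
  simp only [Fin.cons_zero, Fin.cons_succ, prod_const, card_univ, Fintype.card_fin, one_mul]
  have hv := vdm_pos hx
  change |_ * (_ * (vdm x * _))| = _
  rw [abs_mul, abs_mul, abs_mul, abs_pow, abs_neg, abs_of_pos hz, abs_of_pos hv,
    dacoef_det (da_y_strict hx hy) (x 0) (fun i => da_ne hx hy 0 i), Finset.prod_inv_distrib,
    abs_inv]
  have : |∏ j, ∏ i, (x j - x (j.succAbove i))| = vdm x ^ 2 := by
    simp only [Finset.abs_prod]
    rw [prod_succAbove_sq, abs_of_pos hv]
  rw [this]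
  field_simp


noncomputable def daT {k : ℕ} (x : Fin (k + 1) → ℝ) (z : Fin (k + 1) → ℝ) : Fin (k + 1) → ℝ :=
  fun j => z 0 * daw x (Fin.tail z) j

def daS {k : ℕ} (x : Fin (k + 1) → ℝ) : Set (Fin (k + 1) → ℝ) :=
  {z | 0 < z 0 ∧ Fin.tail z ∈ DAint k x}

lemma daT_deriv {k : ℕ} {x : Fin (k + 1) → ℝ} (hx : StrictMono x) (z : Fin (k + 1) → ℝ)
    (hz : z ∈ daS x) :
    HasFDerivAt (daT x) (LinearMap.toContinuousLinearMap (Matrix.toLin' (daM x z))) z := by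
  rw [hasFDerivAt_pi']
  intro j
  have h0 : HasFDerivAt (fun z : Fin (k + 1) → ℝ => z 0)
      (ContinuousLinearMap.proj (R := ℝ) (φ := fun _ : Fin (k + 1) => ℝ) 0) z :=
    hasFDerivAt_apply 0 z
  have hs : ∀ i : Fin k, HasFDerivAt
      (fun z : Fin (k + 1) → ℝ => (x j - Fin.tail z i) / (x j - x (j.succAbove i)))
      ((x j - x (j.succAbove i))⁻¹ •
        (-(ContinuousLinearMap.proj (R := ℝ) (φ := fun _ : Fin (k + 1) => ℝ) i.succ))) z := by
    intro i
    have := ((hasFDerivAt_apply (𝕜 := ℝ) (F' := fun _ : Fin (k + 1) => ℝ) i.succ z).const_sub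
      (x j)).mul_const (x j - x (j.succAbove i))⁻¹
    simpa [div_eq_mul_inv, Fin.tail] using this
  have hp := HasFDerivAt.finsetProd (u := univ) (fun i _ => hs i)
  have := h0.mul hp
  refine this.congr_fderiv ?_
  ext v
  simp only [ContinuousLinearMap.coe_comp, Function.comp_apply, ContinuousLinearMap.proj_apply,
    LinearMap.coe_toContinuousLinearMap', Matrix.toLin'_apply, Matrix.mulVec, dotProduct,
    _root_.add_apply, _root_.smul_apply, smul_eq_mul,
    _root_.sum_apply, _root_.neg_apply]
  rw [Fin.sum_univ_succ, add_comm, Finset.mul_sum]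
  simp only [daM, Matrix.of_apply, Fin.cons_zero, Fin.cons_succ, daw]
  congr 1
  refine Finset.sum_congr rfl fun i _ => ?_
  rw [← Finset.mul_prod_erase univ _ (mem_univ i)]
  have := da_ne hx hz.2 j i
  field_simp

lemma daT_inj {k : ℕ} {x : Fin (k + 1) → ℝ} (hx : StrictMono x) : Set.InjOn (daT x) (daS x) := by
  intro z hz z' hz' h
  have h0 : z 0 = z' 0 := by
    have := congrArg (fun f => ∑ j, f j) h
    simpa [daT, ← Finset.mul_sum, daw_sum x hx.injective] using this
  have hw : ∀ j, daw x (Fin.tail z) j = daw x (Fin.tail z') j := by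
    intro j
    have := congrFun h j
    simp only [daT, h0] at this
    exact mul_left_cancel₀ hz'.1.ne' this
  have hp : ∀ t, ∏ i, (t - Fin.tail z i) = ∏ i, (t - Fin.tail z' i) := by
    intro t
    rw [da_lagr_eval x hx.injective, da_lagr_eval x hx.injective]
    simp only [hw]
  have ht : ∀ i, Fin.tail z i = Fin.tail z' i := by
    intro i
    have h1 := hp (Fin.tail z i)
    rw [Finset.prod_eq_zero (mem_univ i) (sub_self _)] at h1
    obtain ⟨l, -, hl⟩ := Finset.prod_eq_zero_iff.1 h1.symm
    have hl' := sub_eq_zero.1 hl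
    have a := hz.2 i
    have b := hz'.2 l
    rcases lt_trichotomy i l with hh | hh | hh
    · have : x i.succ ≤ x l.castSucc := hx.monotone (by rw [Fin.le_def]; simp; exact hh)
      linarith [a.2, b.1]
    · rw [hh] at hl' ⊢; exact hl'
    · have : x l.succ ≤ x i.castSucc := hx.monotone (by rw [Fin.le_def]; simp; exact hh)
      linarith [a.1, b.2]
  funext j
  refine Fin.cases h0 (fun i => ht i) j

lemma da_sign {k : ℕ} {x : Fin (k + 1) → ℝ} (hx : StrictMono x) (i : Fin k) :
    (∏ l, (x i.castSucc - x (i.castSucc.succAbove l))) *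
      (∏ l, (x i.succ - x (i.succ.succAbove l))) < 0 := by
  set y : Fin k → ℝ := fun l => (x l.castSucc + x l.succ) / 2 with hyd
  have hy : y ∈ DAint k x := by
    intro l
    have : x l.castSucc < x l.succ := hx (Fin.castSucc_lt_succ)
    simp only [hyd]
    constructor <;> linarith
  have hN : ∀ j, ∏ l, (x j - y l) = daw x y j * ∏ l, (x j - x (j.succAbove l)) := by
    intro j
    rw [daw, ← Finset.prod_mul_distrib]
    refine Finset.prod_congr rfl fun l _ => ?_
    have : x j - x (j.succAbove l) ≠ 0 :=
      sub_ne_zero.2 fun h => (Fin.succAbove_ne j l) (hx.injective h).symm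
    field_simp
  have hneg : (∏ l, (x i.castSucc - y l)) * (∏ l, (x i.succ - y l)) < 0 := by
    rw [← Finset.prod_mul_distrib, ← Finset.mul_prod_erase _ _ (mem_univ i)]
    refine mul_neg_of_neg_of_pos ?_ ?_
    · have := hy i
      exact mul_neg_of_neg_of_pos (by linarith) (by linarith)
    · refine Finset.prod_pos fun l hl => ?_
      have hli := (Finset.mem_erase.1 hl).1
      have b := hy l
      rcases lt_or_gt_of_ne hli with hh | hh
      · have h1 : x l.succ ≤ x i.castSucc := hx.monotone (by rw [Fin.le_def]; simp; exact hh)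
        have h2 : x i.castSucc < x i.succ := hx (Fin.castSucc_lt_succ)
        exact mul_pos (by linarith) (by linarith)
      · have h1 : x i.succ ≤ x l.castSucc := hx.monotone (by rw [Fin.le_def]; simp; exact hh)
        have h2 : x i.castSucc < x i.succ := hx (Fin.castSucc_lt_succ)
        exact mul_pos_of_neg_of_neg (by linarith) (by linarith)
  rw [hN, hN] at hneg
  have p1 := daw_pos hx hy i.castSucc
  have p2 := daw_pos hx hy i.succ
  have p3 := mul_pos p1 p2
  by_contra hc
  push Not at hc
  have := mul_nonneg p3.le hc
  nlinarith

lemma daT_image {k : ℕ} {x : Fin (k + 1) → ℝ} (hx : StrictMono x) :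
    daT x '' daS x = Set.univ.pi fun _ => Set.Ioi 0 := by
  ext g
  constructor
  · rintro ⟨z, hz, rfl⟩ j _
    exact mul_pos hz.1 (daw_pos hx hz.2 j)
  · intro hg
    have hg' : ∀ j, 0 < g j := fun j => hg j trivial
    set h : Polynomial ℝ := ∑ j, Polynomial.C (g j) *
        ∏ i, (Polynomial.X - Polynomial.C (x (j.succAbove i))) with hh
    have hev : ∀ j, h.eval (x j) = g j * ∏ l, (x j - x (j.succAbove l)) := by
      intro j
      rw [hh, Polynomial.eval_finsetSum, Finset.sum_eq_single j]
      · simp [Polynomial.eval_prod]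
      · intro l _ hl
        obtain ⟨i, hi⟩ := Fin.exists_succAbove_eq hl.symm
        simp only [Polynomial.eval_prod, Polynomial.eval_mul, Polynomial.eval_sub,
          Polynomial.eval_X, Polynomial.eval_C]
        rw [Finset.prod_eq_zero (mem_univ i), mul_zero]
        rw [hi, sub_self]
      · simp
    have hroot : ∀ i : Fin k, ∃ t, (x i.castSucc < t ∧ t < x i.succ) ∧ h.eval t = 0 := by
      intro i
      have hlt : x i.castSucc < x i.succ := hx (Fin.castSucc_lt_succ)
      have hs : h.eval (x i.castSucc) * h.eval (x i.succ) < 0 := by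
        rw [hev, hev]
        have := da_sign hx i
        have p3 := mul_pos (hg' i.castSucc) (hg' i.succ)
        nlinarith
      rcases mul_neg_iff.1 hs with ⟨h1, h2⟩ | ⟨h1, h2⟩
      · obtain ⟨t, ht, ht0⟩ := intermediate_value_Ioo' hlt.le h.continuous.continuousOn ⟨h2, h1⟩
        exact ⟨t, ht, ht0⟩
      · obtain ⟨t, ht, ht0⟩ := intermediate_value_Ioo hlt.le h.continuous.continuousOn ⟨h1, h2⟩
        exact ⟨t, ht, ht0⟩
    choose y hy hy0 using hroot
    have hyI : y ∈ DAint k x := hy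
    refine ⟨Fin.cons (∑ j, g j) y, ⟨?_, ?_⟩, ?_⟩
    · simp only [Fin.cons_zero]
      exact Finset.sum_pos (fun j _ => hg' j) univ_nonempty
    · simpa using hyI
    · set p : Polynomial ℝ := Polynomial.C (∑ j, g j) *
        ∏ i, (Polynomial.X - Polynomial.C (y i)) with hp
      have hND : ∀ z : Fin k → ℝ,
          (∏ i, (Polynomial.X - Polynomial.C (z i)) : Polynomial ℝ).natDegree = k := by
        intro z
        rw [Polynomial.natDegree_prod _ _ (fun i _ => Polynomial.X_sub_C_ne_zero _)]
        simp
      have hdeg : (p - h).degree < ((k : ℕ) : WithBot ℕ) := by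
        rw [Polynomial.degree_lt_iff_coeff_zero]
        intro m hm
        simp only [hp, hh, Polynomial.coeff_sub, Polynomial.finsetSum_coeff,
          Polynomial.coeff_C_mul]
        rcases hm.eq_or_lt with rfl | hm
        · simp only [da_coeff]; simp
        · have : ∀ z : Fin k → ℝ,
            (∏ i, (Polynomial.X - Polynomial.C (z i)) : Polynomial ℝ).coeff m = 0 := fun z =>
              Polynomial.coeff_eq_zero_of_natDegree_lt (by rw [hND]; exact hm)
          simp only [this]; simp
      have hph : p - h = 0 := by
        refine Polynomial.eq_zero_of_degree_lt_of_eval_index_eq_zero (s := univ) (v := y)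
          (da_y_strict hx hyI).injective.injOn (by simpa using hdeg) ?_
        intro i _
        rw [Polynomial.eval_sub, hy0 i, sub_zero, hp, Polynomial.eval_mul, Polynomial.eval_prod,
          Finset.prod_eq_zero (mem_univ i) (by simp), mul_zero]
      have hph' : p = h := sub_eq_zero.1 hph
      funext j
      have h1 := hev j
      rw [← hph', hp, Polynomial.eval_mul, Polynomial.eval_prod, Polynomial.eval_C] at h1
      have hNj : ∀ l, x j - x (j.succAbove l) ≠ 0 := fun l =>
        sub_ne_zero.2 fun h => (Fin.succAbove_ne j l) (hx.injective h).symm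
      have hNp : ∏ l, (x j - x (j.succAbove l)) ≠ 0 :=
        Finset.prod_ne_zero_iff.2 fun l _ => hNj l
      simp only [Polynomial.eval_sub, Polynomial.eval_X, Polynomial.eval_C] at h1
      simp only [daT, Fin.cons_zero, Fin.tail_cons, daw, Finset.prod_div_distrib]
      rw [← mul_div_assoc, h1]
      field_simp

lemma DAint_eq {k : ℕ} (x : Fin (k + 1) → ℝ) :
    DAint k x = Set.univ.pi fun i : Fin k => Set.Ioo (x i.castSucc) (x i.succ) := by
  ext y; simp [DAint]

lemma DAint_meas {k : ℕ} (x : Fin (k + 1) → ℝ) : MeasurableSet (DAint k x) := by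
  rw [DAint_eq]
  exact MeasurableSet.univ_pi fun i => measurableSet_Ioo

lemma DA_ae {k : ℕ} (x : Fin (k + 1) → ℝ) : DAint k x =ᵐ[volume] DAdomain k x := by
  have h : DAdomain k x = Set.Icc (fun i : Fin k => x i.castSucc) (fun i => x i.succ) := by
    ext y
    simp only [DAdomain, Set.mem_ofPred_eq, Set.mem_Icc, Pi.le_def]
    exact forall_and
  rw [DAint_eq, h]
  exact Measure.univ_pi_Ioo_ae_eq_Icc

/-- Dixon-Anderson integral, general exponents. -/
lemma da_integral {k : ℕ} {x : Fin (k + 1) → ℝ} (hx : StrictMono x) (s : Fin (k + 1) → ℝ)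
    (hs : ∀ j, 0 < s j) :
    ∫ y in DAint k x, vdm y / vdm x * ∏ j, daw x y j ^ (s j - 1) =
      (∏ j, Real.Gamma (s j)) / Real.Gamma (∑ j, s j) := by
  set F : (Fin (k + 1) → ℝ) → ℝ := fun g => ∏ j, (Real.exp (-(g j)) * (g j) ^ (s j - 1)) with hF
  set e := MeasurableEquiv.piFinSuccAbove (fun _ : Fin (k + 1) => ℝ) 0 with he
  have hmp := volume_preserving_piFinSuccAbove (fun _ : Fin (k + 1) => ℝ) 0
  have hpre : daS x = e ⁻¹' (Set.Ioi 0 ×ˢ DAint k x) := by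
    ext z
    simp only [daS, Set.mem_ofPred_eq, Set.mem_preimage, Set.mem_prod, he]
    rfl
  have hSm : MeasurableSet (daS x) := by
    rw [hpre]
    exact e.measurable (measurableSet_Ioi.prod (DAint_meas x))
  have h1 : ∫ g in (Set.univ.pi fun _ : Fin (k + 1) => Set.Ioi (0 : ℝ)), F g =
      ∏ j, Real.Gamma (s j) := by
    rw [volume_pi, Measure.restrict_pi_pi]
    rw [hF, integral_fintype_prod_eq_prod (fun j (t : ℝ) => Real.exp (-t) * t ^ (s j - 1))]
    refine Finset.prod_congr rfl fun j _ => ?_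
    rw [Real.Gamma_eq_integral (hs j)]
  have h2 := integral_image_eq_integral_abs_det_fderiv_smul volume hSm
    (fun z hz => (daT_deriv hx z hz).hasFDerivWithinAt) (daT_inj hx) F
  rw [daT_image hx, h1] at h2
  set G : ℝ × (Fin k → ℝ) → ℝ := fun q =>
    (Real.exp (-q.1) * q.1 ^ ((∑ j, s j) - 1)) *
      (vdm q.2 / vdm x * ∏ j, daw x q.2 j ^ (s j - 1)) with hG
  have h3 : ∫ z in daS x, |(LinearMap.toContinuousLinearMap (Matrix.toLin' (daM x z))).det| •
      F (daT x z) = ∫ z in daS x, G (e z) := by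
    refine setIntegral_congr_fun hSm fun z hz => ?_
    have hez : e z = (z 0, Fin.tail z) := rfl
    have hd : (LinearMap.toContinuousLinearMap (Matrix.toLin' (daM x z))).det = (daM x z).det := by
      rw [ContinuousLinearMap.det]
      simp
    simp only [hez, hG, hF]
    rw [hd, daM_det hx z hz.1 hz.2, smul_eq_mul]
    simp only [daT]
    have hz0 := hz.1
    rw [Finset.prod_mul_distrib, ← Real.exp_sum, Finset.sum_neg_distrib, ← Finset.mul_sum,
      daw_sum x hx.injective, mul_one]
    have : ∏ j, (z 0 * daw x (Fin.tail z) j) ^ (s j - 1) =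
        z 0 ^ (∑ j, (s j - 1)) * ∏ j, daw x (Fin.tail z) j ^ (s j - 1) := by
      rw [Real.rpow_sum_of_pos hz0, ← Finset.prod_mul_distrib]
      exact Finset.prod_congr rfl fun j _ =>
        Real.mul_rpow hz0.le (daw_pos hx hz.2 j).le
    rw [this]
    have h5 : z 0 ^ ((∑ j, s j) - 1) = z 0 ^ k * z 0 ^ (∑ j, (s j - 1)) := by
      rw [← Real.rpow_natCast, ← Real.rpow_add hz0]
      congr 1
      simp
      ring
    rw [h5]
    ring
  have h4 : ∫ z in daS x, G (e z) = ∫ q in Set.Ioi 0 ×ˢ DAint k x, G q := by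
    rw [hpre]
    exact hmp.setIntegral_preimage_emb e.measurableEmbedding G _
  rw [h3, h4, hG, Measure.volume_eq_prod, setIntegral_prod_mul
    (fun r : ℝ => Real.exp (-r) * r ^ ((∑ j, s j) - 1))
    (fun y : Fin k → ℝ => vdm y / vdm x * ∏ j, daw x y j ^ (s j - 1))] at h2
  have hS : 0 < ∑ j, s j := Finset.sum_pos (fun j _ => hs j) univ_nonempty
  rw [← Real.Gamma_eq_integral hS] at h2
  rw [h2]
  field_simp [(Real.Gamma_pos_of_pos hS).ne']


/-- Dirichlet moments. -/
noncomputable def dmom (n : ℕ) (θ : ℝ) (a : Fin n → ℕ) : ℝ :=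
  Real.Gamma (∑ _j : Fin n, θ) / Real.Gamma (∑ j, (θ + a j)) *
    ∏ j, (Real.Gamma (θ + a j) / Real.Gamma θ)

lemma dmom_pos {n : ℕ} (hn : 0 < n) {θ : ℝ} (hθ : 0 < θ) (a : Fin n → ℕ) : 0 < dmom n θ a := by
  have : Nonempty (Fin n) := ⟨⟨0, hn⟩⟩
  have h : ∀ j, 0 < θ + a j := fun j => by positivity
  have h1 : 0 < ∑ j, (θ + a j) := Finset.sum_pos (fun j _ => h j) univ_nonempty
  have h2 : 0 < ∑ _j : Fin n, θ := Finset.sum_pos (fun j _ => hθ) univ_nonempty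
  refine mul_pos (div_pos (Real.Gamma_pos_of_pos h2) (Real.Gamma_pos_of_pos h1)) ?_
  exact Finset.prod_pos fun j _ =>
    div_pos (Real.Gamma_pos_of_pos (h j)) (Real.Gamma_pos_of_pos hθ)

lemma dmom_succ {n : ℕ} {θ : ℝ} (hθ : 0 < θ) (a b : Fin n → ℕ) (m : Fin n)
    (hm : b m = a m + 1) (hb : ∀ j, j ≠ m → b j = a j) :
    dmom n θ b * (∑ j, (θ + a j)) = dmom n θ a * (θ + a m) := by
  have : Nonempty (Fin n) := ⟨m⟩
  have h : ∀ j, 0 < θ + a j := fun j => by positivity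
  have h1 : 0 < ∑ j, (θ + a j) := Finset.sum_pos (fun j _ => h j) univ_nonempty
  have hsum : ∑ j, (θ + b j) = ∑ j, (θ + a j) + 1 := by
    rw [← Finset.add_sum_erase _ _ (mem_univ m), ← Finset.add_sum_erase univ (fun j => θ + (a j : ℝ)) (mem_univ m),
      Finset.sum_congr rfl (fun j hj => by rw [hb j (Finset.mem_erase.1 hj).1]), hm]
    push_cast; ring
  have hprod : ∏ j, (Real.Gamma (θ + b j) / Real.Gamma θ) =
      (θ + a m) * ∏ j, (Real.Gamma (θ + a j) / Real.Gamma θ) := by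
    rw [← Finset.mul_prod_erase _ _ (mem_univ m),
      ← Finset.mul_prod_erase univ (fun j => Real.Gamma (θ + a j) / Real.Gamma θ) (mem_univ m),
      Finset.prod_congr rfl (fun j hj => by rw [hb j (Finset.mem_erase.1 hj).1]), hm]
    push_cast
    rw [← add_assoc, Real.Gamma_add_one (h m).ne']
    ring
  rw [dmom, dmom, hsum, hprod, Real.Gamma_add_one h1.ne']
  have := (Real.Gamma_pos_of_pos h1).ne'
  field_simp

lemma DAdensity_eq {k : ℕ} {β : ℝ} {x : Fin (k + 1) → ℝ} (hx : StrictMono x)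
    {y : Fin k → ℝ} (hy : y ∈ DAint k x) :
    DAdensity k β x y = (Real.Gamma (β * (k + 1) / 2) / Real.Gamma (β / 2) ^ (k + 1)) *
      (vdm y / vdm x * ∏ j, daw x y j ^ (β / 2 - 1)) := by
  have hv := vdm_pos hx
  have h1 : ∏ i : Fin (k + 1), ∏ j ∈ Ioi i, (x j - x i) ^ (1 - β) = vdm x ^ (1 - β) := by
    rw [vdm, ← Real.finsetProd_rpow]
    · refine Finset.prod_congr rfl fun i _ => ?_
      rw [Real.finsetProd_rpow]
      exact fun j hj => (sub_pos.2 (hx (mem_Ioi.1 hj))).le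
    · exact fun i _ => Finset.prod_nonneg fun j hj => (sub_pos.2 (hx (mem_Ioi.1 hj))).le
  have h2 : ∏ i : Fin k, ∏ j : Fin (k + 1), |y i - x j| ^ (β / 2 - 1) =
      (∏ j, ∏ i, |x j - y i|) ^ (β / 2 - 1) := by
    rw [Finset.prod_comm, ← Real.finsetProd_rpow _ _ (fun j _ => Finset.prod_nonneg fun i _ => abs_nonneg _)]
    refine Finset.prod_congr rfl fun j _ => ?_
    rw [← Real.finsetProd_rpow _ _ (fun i _ => abs_nonneg _)]
    exact Finset.prod_congr rfl fun i _ => by rw [abs_sub_comm]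
  have h3 : ∏ j, daw x y j ^ (β / 2 - 1) =
      ((∏ j, ∏ i, |x j - y i|) / vdm x ^ 2) ^ (β / 2 - 1) := by
    rw [Real.finsetProd_rpow _ _ (fun j _ => (daw_pos hx hy j).le)]
    congr 1
    have : |vdm x| ^ 2 = vdm x ^ 2 := sq_abs _
    rw [← this, ← prod_succAbove_sq, ← Finset.prod_div_distrib]
    refine Finset.prod_congr rfl fun j _ => ?_
    rw [← Finset.prod_div_distrib, daw]
    refine Finset.prod_congr rfl fun i _ => ?_
    rw [← abs_div, abs_of_pos (da_cases hx hy j i)]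
  rw [DAdensity, h1, h2, h3, Real.div_rpow (Finset.prod_nonneg fun j _ =>
    Finset.prod_nonneg fun i _ => abs_nonneg _) (by positivity)]
  have h4 : (vdm x ^ 2) ^ (β / 2 - 1) = vdm x ^ (β - 2) := by
    rw [← Real.rpow_natCast, ← Real.rpow_mul hv.le]
    congr 1; push_cast; ring
  have h5 : vdm x ^ (1 - β) = (vdm x ^ (β - 2))⁻¹ * (vdm x)⁻¹ := by
    rw [← Real.rpow_neg hv.le, ← Real.rpow_neg_one, ← Real.rpow_add hv]
    congr 1; ring
  rw [h4, h5]
  change _ * _ * vdm y * _ = _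
  ring

lemma da_moment {k : ℕ} {β : ℝ} (hβ : 0 < β) {x : Fin (k + 1) → ℝ} (hx : StrictMono x)
    (a : Fin (k + 1) → ℕ) :
    ∫ y in DAint k x, DAdensity k β x y * ∏ j, daw x y j ^ a j = dmom (k + 1) (β / 2) a := by
  have hθ : 0 < β / 2 := by positivity
  have h := da_integral hx (fun j => β / 2 + a j) (fun j => by positivity)
  have h1 : ∫ y in DAint k x, DAdensity k β x y * ∏ j, daw x y j ^ a j =
      ∫ y in DAint k x, (Real.Gamma (β * (k + 1) / 2) / Real.Gamma (β / 2) ^ (k + 1)) *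
        (vdm y / vdm x * ∏ j, daw x y j ^ (β / 2 + a j - 1)) := by
    refine setIntegral_congr_fun (DAint_meas x) fun y hy => ?_
    rw [DAdensity_eq hx hy]
    have : ∏ j, daw x y j ^ (β / 2 + a j - 1) =
        (∏ j, daw x y j ^ (β / 2 - 1)) * ∏ j, daw x y j ^ a j := by
      rw [← Finset.prod_mul_distrib]
      refine Finset.prod_congr rfl fun j _ => ?_
      rw [← Real.rpow_natCast, ← Real.rpow_add (daw_pos hx hy j)]
      congr 1; ring
    rw [this]
    ring
  rw [h1, integral_const_mul, h, dmom, Finset.prod_div_distrib]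
  have : ∑ _j : Fin (k + 1), β / 2 = β * (k + 1) / 2 := by simp; ring
  rw [this]
  simp
  ring

lemma da_moment_integrable {k : ℕ} {β : ℝ} (hβ : 0 < β) {x : Fin (k + 1) → ℝ} (hx : StrictMono x)
    (a : Fin (k + 1) → ℕ) :
    IntegrableOn (fun y => DAdensity k β x y * ∏ j, daw x y j ^ a j) (DAint k x) := by
  refine Integrable.of_integral_ne_zero ?_
  rw [da_moment hβ hx]
  exact (dmom_pos (Nat.succ_pos k) (by positivity) a).ne'


lemma hd_prod {ι : Type*} [Fintype ι] [DecidableEq ι] (v : ι → ℝ) (t : ℝ) (h : ∀ i, t - v i ≠ 0) :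
    HasDerivAt (fun t => ∏ i, (t - v i)) ((∏ i, (t - v i)) * ∑ i, (t - v i)⁻¹) t := by
  have := HasDerivAt.fun_finsetProd (u := univ) (fun i (_ : i ∈ univ) => (hasDerivAt_id t).sub_const (v i))
  refine (this.congr_deriv ?_)
  rw [Finset.mul_sum]
  refine Finset.sum_congr rfl fun i _ => ?_
  rw [← Finset.mul_prod_erase univ _ (mem_univ i)]
  have := h i
  simp
  field_simp

lemma hd_inv {ι : Type*} [Fintype ι] (c v : ι → ℝ) (t : ℝ) (n : ℕ) (h : ∀ i, t - v i ≠ 0) :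
    HasDerivAt (fun t => ∑ i, c i * (t - v i)⁻¹ ^ n) (-(n : ℝ) * ∑ i, c i * (t - v i)⁻¹ ^ (n + 1)) t := by
  have := HasDerivAt.fun_sum (u := univ) (fun i (_ : i ∈ univ) =>
    ((((hasDerivAt_id t).sub_const (v i)).fun_inv (h i)).fun_pow n).const_mul (c i))
  refine (this.congr_deriv ?_)
  rw [Finset.mul_sum]
  refine Finset.sum_congr rfl fun i _ => ?_
  have := h i
  cases n with
  | zero => simp
  | succ n =>
    have hw : -1 / (id t - v i) ^ 2 = -((t - v i)⁻¹ ^ 2) := by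
      rw [inv_pow, id, neg_div, one_div]
    rw [hw]
    simp only [id, Nat.add_sub_cancel]
    push_cast
    ring

section
variable {k : ℕ} {x g : Fin (k + 1) → ℝ} {y : Fin k → ℝ}

lemma erase_prod (x : Fin (k + 1) → ℝ) (t : ℝ) (h : ∀ i, t - x i ≠ 0) (j : Fin (k + 1)) :
    ∏ l ∈ univ.erase j, (t - x l) = (∏ l, (t - x l)) * (t - x j)⁻¹ := by
  rw [← Finset.mul_prod_erase univ _ (mem_univ j)]
  have := h j
  field_simp

lemma gen_D0 (hL : ∀ t, ∏ i, (t - y i) = ∑ j, g j * ∏ l ∈ univ.erase j, (t - x l)) (t : ℝ)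
    (hx : ∀ i, t - x i ≠ 0) :
    ∏ i, (t - y i) = (∏ l, (t - x l)) * ∑ j, g j * (t - x j)⁻¹ ^ 1 := by
  rw [hL, Finset.mul_sum]
  refine Finset.sum_congr rfl fun j _ => ?_
  rw [erase_prod x t hx]
  ring

lemma gen_ev {n : ℕ} (v : Fin n → ℝ) (t : ℝ) (h : ∀ i, t - v i ≠ 0) :
    ∀ᶠ s in nhds t, ∀ i, s - v i ≠ 0 := by
  rw [Filter.eventually_all]
  intro i
  exact (continuous_id.sub continuous_const).continuousAt.eventually_ne (h i)

lemma gen_D1 (hL : ∀ t, ∏ i, (t - y i) = ∑ j, g j * ∏ l ∈ univ.erase j, (t - x l)) (t : ℝ)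
    (hx : ∀ i, t - x i ≠ 0) (hy : ∀ i, t - y i ≠ 0) :
    (∏ i, (t - y i)) * (∑ i, (t - y i)⁻¹) =
      (∏ l, (t - x l)) * ((∑ j, (t - x j)⁻¹) * (∑ j, g j * (t - x j)⁻¹ ^ 1) -
        ∑ j, g j * (t - x j)⁻¹ ^ 2) := by
  have h1 := hd_prod y t hy
  have h2 := (hd_prod x t hx).fun_mul (hd_inv g x t 1 hx)
  have h3 : (fun t => ∏ i, (t - y i)) =ᶠ[nhds t]
      fun t => (∏ l, (t - x l)) * ∑ j, g j * (t - x j)⁻¹ ^ 1 := by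
    filter_upwards [gen_ev x t hx] with s hs
    exact gen_D0 hL s hs
  have h4 := (h2.congr_of_eventuallyEq h3).unique h1
  rw [← h4]
  push_cast
  ring

lemma gen_D2 (hL : ∀ t, ∏ i, (t - y i) = ∑ j, g j * ∏ l ∈ univ.erase j, (t - x l)) (t : ℝ)
    (hx : ∀ i, t - x i ≠ 0) (hy : ∀ i, t - y i ≠ 0) :
    (∏ i, (t - y i)) * ((∑ i, (t - y i)⁻¹) ^ 2 - ∑ i, (t - y i)⁻¹ ^ 2) =
      (∏ l, (t - x l)) * (((∑ j, (t - x j)⁻¹) ^ 2 - ∑ j, (t - x j)⁻¹ ^ 2) *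
        (∑ j, g j * (t - x j)⁻¹ ^ 1) -
        2 * (∑ j, (t - x j)⁻¹) * ∑ j, g j * (t - x j)⁻¹ ^ 2 +
        2 * ∑ j, g j * (t - x j)⁻¹ ^ 3) := by
  have hS : ∀ {n : ℕ} (v : Fin n → ℝ), (∀ i, t - v i ≠ 0) →
      HasDerivAt (fun t => ∑ i, (t - v i)⁻¹) (- ∑ i, (t - v i)⁻¹ ^ 2) t := by
    intro n v hv
    have := hd_inv (fun _ => 1) v t 1 hv
    simpa using this
  have h1 := (hd_prod y t hy).fun_mul (hS y hy)
  have h2 := (hd_prod x t hx).fun_mul (((hS x hx).fun_mul (hd_inv g x t 1 hx)).fun_sub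
    (hd_inv g x t 2 hx))
  have h3 : (fun t => (∏ i, (t - y i)) * (∑ i, (t - y i)⁻¹)) =ᶠ[nhds t]
      fun t => (∏ l, (t - x l)) * ((∑ j, (t - x j)⁻¹) * (∑ j, g j * (t - x j)⁻¹ ^ 1) -
        ∑ j, g j * (t - x j)⁻¹ ^ 2) := by
    filter_upwards [gen_ev x t hx, gen_ev y t hy] with s hs hs'
    exact gen_D1 hL s hs hs'
  have h4 := (h2.congr_of_eventuallyEq h3).unique h1
  push_cast at h4
  linear_combination -h4

/-- x-derivative of generator -/
noncomputable def hX (x g : Fin (k + 1) → ℝ) (i : Fin (k + 1)) (t : ℝ) : ℝ :=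
  -∑ j ∈ univ.erase i, g j * ∏ l ∈ (univ.erase j).erase i, (t - x l)
noncomputable def hG (x : Fin (k + 1) → ℝ) (j : Fin (k + 1)) (t : ℝ) : ℝ :=
  ∏ l ∈ univ.erase j, (t - x l)
noncomputable def eY (y : Fin k → ℝ) (i : Fin k) (t : ℝ) : ℝ :=
  -∏ l ∈ univ.erase i, (t - y l)

lemma hX_gen (t : ℝ) (hx : ∀ i, t - x i ≠ 0) (i : Fin (k + 1)) :
    hX x g i t = - (∏ l, (t - x l)) * (t - x i)⁻¹ *
      ((∑ j, g j * (t - x j)⁻¹ ^ 1) - g i * (t - x i)⁻¹) := by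
  rw [← Finset.add_sum_erase univ _ (mem_univ i), hX]
  simp only [pow_one, add_sub_cancel_left]
  rw [neg_mul, neg_mul, neg_inj, Finset.mul_sum]
  refine Finset.sum_congr rfl fun j hj => ?_
  have hij : i ∈ univ.erase j := by simp [(Finset.mem_erase.1 hj).1.symm]
  have h1 := erase_prod x t hx j
  rw [← Finset.mul_prod_erase _ _ hij] at h1
  have := hx i
  have := hx j
  field_simp at h1 ⊢
  linear_combination g j * h1

lemma hG_gen (t : ℝ) (hx : ∀ i, t - x i ≠ 0) (j : Fin (k + 1)) :
    hG x j t = (∏ l, (t - x l)) * (t - x j)⁻¹ := erase_prod x t hx j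

lemma eY_gen (t : ℝ) (hy : ∀ i, t - y i ≠ 0) (i : Fin k) :
    eY y i t = - (∏ l, (t - y l)) * (t - y i)⁻¹ := by
  rw [eY, ← Finset.mul_prod_erase univ _ (mem_univ i)]
  have := hy i
  field_simp

lemma offdiag {n : ℕ} (F : Fin n → Fin n → ℝ) :
    ∑ i, ∑ j ∈ univ.erase i, F i j = ∑ i, ∑ j, F i j - ∑ i, F i i := by
  rw [← Finset.sum_sub_distrib]
  refine Finset.sum_congr rfl fun i _ => ?_
  rw [← Finset.add_sum_erase univ _ (mem_univ i)]
  ring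

lemma offdiag_symm {n : ℕ} (F : Fin n → Fin n → ℝ) :
    ∑ i, ∑ j ∈ univ.erase i, F i j = 1 / 2 * ∑ i, ∑ j ∈ univ.erase i, (F i j + F j i) := by
  have h : ∑ i, ∑ j ∈ univ.erase i, F i j = ∑ i, ∑ j ∈ univ.erase i, F j i := by
    rw [offdiag, offdiag, Finset.sum_comm]
  simp only [Finset.sum_add_distrib]
  rw [← h]; ring

lemma gen_b0 (hL : ∀ t, ∏ i, (t - y i) = ∑ j, g j * ∏ l ∈ univ.erase j, (t - x l)) (t s : ℝ)
    (hxi : Function.Injective x) (hts : t ≠ s)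
    (hx : ∀ i, t - x i ≠ 0) (hy : ∀ i, t - y i ≠ 0)
    (hx' : ∀ i, s - x i ≠ 0) (hy' : ∀ i, s - y i ≠ 0) :
    ∑ i, hX x g i t * hX x g i s + ∑ m, ∑ n ∈ univ.erase m,
      g m * g n * ((x m - x n) ^ 2)⁻¹ * ((hG x m t - hG x n t) * (hG x m s - hG x n s)) =
    ∑ i, eY y i t * eY y i s := by
  have hτ : s - t ≠ 0 := sub_ne_zero.2 hts.symm
  set Pt := ∏ l, (t - x l) with hPt
  set Ps := ∏ l, (s - x l) with hPs
  set u : Fin (k + 1) → ℝ := fun j => (t - x j)⁻¹ with hu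
  set v : Fin (k + 1) → ℝ := fun j => (s - x j)⁻¹ with hv
  set U := ∑ j, g j * (t - x j)⁻¹ ^ 1 with hU
  set V := ∑ j, g j * (s - x j)⁻¹ ^ 1 with hV
  have huv : ∀ j, u j - v j = (s - t) * (u j * v j) := by
    intro j
    have := hx j
    have := hx' j
    simp only [hu, hv]
    field_simp
    ring
  have e1 : ∑ i, hX x g i t * hX x g i s =
      Pt * Ps * ∑ i, (U * V * (u i * v i) - U * (g i * (u i * v i ^ 2)) - V * (g i * (u i ^ 2 * v i))
        + g i ^ 2 * (u i * v i) ^ 2) := by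
    rw [Finset.mul_sum]
    refine Finset.sum_congr rfl fun i _ => ?_
    rw [hX_gen t hx, hX_gen s hx']
    simp only [← hPt, ← hPs, ← hU, ← hV, hu, hv]
    ring
  have e2 : ∑ m, ∑ n ∈ univ.erase m,
      g m * g n * ((x m - x n) ^ 2)⁻¹ * ((hG x m t - hG x n t) * (hG x m s - hG x n s)) =
      Pt * Ps * ((∑ i, g i * (u i * v i)) ^ 2 - ∑ i, g i ^ 2 * (u i * v i) ^ 2) := by
    have : ∀ m, ∀ n ∈ univ.erase m,
        g m * g n * ((x m - x n) ^ 2)⁻¹ * ((hG x m t - hG x n t) * (hG x m s - hG x n s)) =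
        Pt * Ps * ((g m * (u m * v m)) * (g n * (u n * v n))) := by
      intro m n hn
      have h0 : x m - x n ≠ 0 := sub_ne_zero.2 fun h => (Finset.mem_erase.1 hn).1 (hxi h).symm
      rw [hG_gen t hx, hG_gen t hx, hG_gen s hx', hG_gen s hx']
      simp only [← hPt, ← hPs]
      have a1 : (t - x m)⁻¹ - (t - x n)⁻¹ = (x m - x n) * (u m * u n) := by
        have := hx m
        have := hx n
        simp only [hu]; field_simp; ring
      have a2 : (s - x m)⁻¹ - (s - x n)⁻¹ = (x m - x n) * (v m * v n) := by
        have := hx' m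
        have := hx' n
        simp only [hv]; field_simp; ring
      rw [← mul_sub, ← mul_sub, a1, a2]
      field_simp
    rw [Finset.sum_congr rfl fun m _ => Finset.sum_congr rfl (this m)]
    rw [offdiag, mul_sub, sq, Finset.sum_mul_sum, Finset.mul_sum, Finset.mul_sum]
    congr 1
    · refine Finset.sum_congr rfl fun m _ => ?_
      rw [Finset.mul_sum]
    · refine Finset.sum_congr rfl fun m _ => ?_
      ring
  have e3 : (s - t) * ∑ i, eY y i t * eY y i s =
      (∏ i, (t - y i)) * (∑ i, (t - y i)⁻¹) * (∏ i, (s - y i)) -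
      (∏ i, (t - y i)) * ((∏ i, (s - y i)) * (∑ i, (s - y i)⁻¹)) := by
    have : ∀ i, (s - t) * (eY y i t * eY y i s) = (∏ i, (t - y i)) * (∏ i, (s - y i)) *
        ((t - y i)⁻¹ - (s - y i)⁻¹) := by
      intro i
      rw [eY_gen t hy, eY_gen s hy']
      have := hy i
      have := hy' i
      field_simp
      ring
    rw [Finset.mul_sum, Finset.sum_congr rfl fun i _ => this i, ← Finset.mul_sum,
      Finset.sum_sub_distrib]
    ring
  rw [gen_D1 hL t hx hy, gen_D1 hL s hx' hy', gen_D0 hL t hx, gen_D0 hL s hx'] at e3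
  simp only [← hPt, ← hPs, ← hU, ← hV] at e3
  have f0 : ∑ j, (t - x j)⁻¹ - ∑ j, (s - x j)⁻¹ = (s - t) * ∑ i, u i * v i := by
    rw [← Finset.sum_sub_distrib, Finset.mul_sum]
    exact Finset.sum_congr rfl fun j _ => huv j
  have f1 : U - V = (s - t) * ∑ i, g i * (u i * v i) := by
    rw [hU, hV, ← Finset.sum_sub_distrib, Finset.mul_sum]
    refine Finset.sum_congr rfl fun j _ => ?_
    have := huv j
    simp only [hu, hv] at this ⊢
    linear_combination g j * this
  have f2 : ∑ i, g i * (u i * v i) - ∑ j, g j * (s - x j)⁻¹ ^ 2 =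
      (s - t) * ∑ i, g i * (u i * v i ^ 2) := by
    rw [← Finset.sum_sub_distrib, Finset.mul_sum]
    refine Finset.sum_congr rfl fun j _ => ?_
    have := huv j
    simp only [hu, hv] at this ⊢
    linear_combination g j * (s - x j)⁻¹ * this
  have f3 : ∑ j, g j * (t - x j)⁻¹ ^ 2 - ∑ i, g i * (u i * v i) =
      (s - t) * ∑ i, g i * (u i ^ 2 * v i) := by
    rw [← Finset.sum_sub_distrib, Finset.mul_sum]
    refine Finset.sum_congr rfl fun j _ => ?_
    have := huv j
    simp only [hu, hv] at this ⊢
    linear_combination g j * (t - x j)⁻¹ * this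
  refine mul_left_cancel₀ hτ ?_
  rw [e3, e1, e2]
  simp only [Finset.sum_add_distrib, Finset.sum_sub_distrib, ← Finset.mul_sum]
  linear_combination Pt * Ps * (-(U * V) * f0 + U * f2 + V * f3 - (∑ i, g i * (u i * v i)) * f1)

lemma gen_a0 (hL : ∀ t, ∏ i, (t - y i) = ∑ j, g j * ∏ l ∈ univ.erase j, (t - x l)) (t θ : ℝ)
    (hxi : Function.Injective x) (hyi : Function.Injective y)
    (hx : ∀ i, t - x i ≠ 0) (hy : ∀ i, t - y i ≠ 0) :
    θ * ∑ i, ∑ j ∈ univ.erase i, 1 / (x i - x j) * hX x g i t -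
      1 / 2 * ∑ m, ∑ n ∈ univ.erase m,
      θ * (g m - g n) * ((x m - x n) ^ 2)⁻¹ * (hG x m t - hG x n t) =
    θ * ∑ i, ∑ j ∈ univ.erase i, 1 / (y i - y j) * eY y i t := by
  have hD := gen_D2 hL t hx hy
  set P := ∏ l, (t - x l) with hP
  set u : Fin (k + 1) → ℝ := fun j => (t - x j)⁻¹ with hu
  set U := ∑ j, g j * (t - x j)⁻¹ ^ 1 with hU
  have e1 : ∑ i, ∑ j ∈ univ.erase i, 1 / (y i - y j) * eY y i t =
      - (1 / 2) * ((∏ i, (t - y i)) * ((∑ i, (t - y i)⁻¹) ^ 2 - ∑ i, (t - y i)⁻¹ ^ 2)) := by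
    rw [offdiag_symm]
    have : ∀ i, ∀ j ∈ univ.erase i, (1 / (y i - y j) * eY y i t + 1 / (y j - y i) * eY y j t) =
        - ((∏ i, (t - y i)) * ((t - y i)⁻¹ * (t - y j)⁻¹)) := by
      intro i j hj
      have h0 : y i - y j ≠ 0 := sub_ne_zero.2 fun h => (Finset.mem_erase.1 hj).1 (hyi h).symm
      have h0' : y j - y i ≠ 0 := sub_ne_zero.2 fun h => (Finset.mem_erase.1 hj).1 (hyi h)
      rw [eY_gen t hy, eY_gen t hy]
      have := hy i
      have := hy j
      have h2 : 1 / (y j - y i) = - (1 / (y i - y j)) := by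
        rw [← neg_sub (y i) (y j), one_div, one_div, inv_neg]
      rw [h2]
      field_simp
      ring
    rw [Finset.sum_congr rfl fun m _ => Finset.sum_congr rfl (this m)]
    rw [offdiag, sq, Finset.sum_mul_sum]
    simp only [Finset.sum_neg_distrib, ← Finset.mul_sum, ← sq]
    ring
  have e2 : ∑ i, ∑ j ∈ univ.erase i, 1 / (x i - x j) * hX x g i t -
      1 / 2 * ∑ m, ∑ n ∈ univ.erase m,
      (g m - g n) * ((x m - x n) ^ 2)⁻¹ * (hG x m t - hG x n t) =
      - (1 / 2) * (P * (((∑ j, (t - x j)⁻¹) ^ 2 - ∑ j, (t - x j)⁻¹ ^ 2) * U -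
        2 * (∑ j, (t - x j)⁻¹) * ∑ j, g j * (t - x j)⁻¹ ^ 2 +
        2 * ∑ j, g j * (t - x j)⁻¹ ^ 3)) := by
    rw [offdiag_symm (fun i j => 1 / (x i - x j) * hX x g i t), ← mul_sub,
      ← Finset.sum_sub_distrib]
    simp only [← Finset.sum_sub_distrib]
    have : ∀ i, ∀ j ∈ univ.erase i, (1 / (x i - x j) * hX x g i t + 1 / (x j - x i) * hX x g j t) -
        (g i - g j) * ((x i - x j) ^ 2)⁻¹ * (hG x i t - hG x j t) =
        -P * (U * (u i * u j) - (g i * u i ^ 2) * u j - u i * (g j * u j ^ 2)) := by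
      intro i j hj
      have h0 : x i - x j ≠ 0 := sub_ne_zero.2 fun h => (Finset.mem_erase.1 hj).1 (hxi h).symm
      rw [hX_gen t hx, hX_gen t hx, hG_gen t hx, hG_gen t hx]
      simp only [← hP, ← hU]
      have h2 : 1 / (x j - x i) = - (1 / (x i - x j)) := by
        rw [← neg_sub (x i) (x j), one_div, one_div, inv_neg]
      rw [h2]
      have a1 : u i - u j = (x i - x j) * (u i * u j) := by
        have := hx i
        have := hx j
        simp only [hu]; field_simp; ring
      change 1 / (x i - x j) * (-P * u i * (U - g i * u i)) +
        -(1 / (x i - x j)) * (-P * u j * (U - g j * u j)) -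
        (g i - g j) * ((x i - x j) ^ 2)⁻¹ * (P * u i - P * u j) = _
      rw [← mul_sub P, a1]
      field_simp
      linear_combination (-P * (U - g i * u i - g j * u j)) * a1
    rw [Finset.sum_congr rfl fun m _ => Finset.sum_congr rfl (this m), offdiag]
    simp only [← Finset.mul_sum, Finset.sum_sub_distrib, ← Finset.sum_mul]
    have c1 : ∑ i, U * (u i * u i) = U * ∑ j, (t - x j)⁻¹ ^ 2 := by
      rw [Finset.mul_sum]
      exact Finset.sum_congr rfl fun i _ => by simp only [hu]; ring
    have c2 : ∑ i, g i * u i ^ 2 * u i = ∑ j, g j * (t - x j)⁻¹ ^ 3 :=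
      Finset.sum_congr rfl fun i _ => by simp only [hu]; ring
    have c3 : ∑ i, u i * (g i * u i ^ 2) = ∑ j, g j * (t - x j)⁻¹ ^ 3 :=
      Finset.sum_congr rfl fun i _ => by simp only [hu]; ring
    have c4 : ∑ i, u i * u i = ∑ j, (t - x j)⁻¹ ^ 2 :=
      Finset.sum_congr rfl fun i _ => by simp only [hu]; ring
    simp only [c2, c3, c4]
    ring
  rw [e1, hD, ← e2, mul_sub]
  congr 1
  simp only [Finset.mul_sum]
  refine Finset.sum_congr rfl fun i _ => Finset.sum_congr rfl fun j _ => ?_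
  ring

end


section
variable {k : ℕ} {x g : Fin (k + 1) → ℝ} {y : Fin k → ℝ}

lemma hX_cont (i : Fin (k + 1)) : Continuous (hX x g i) := by
  unfold hX; fun_prop
lemma hG_cont (i : Fin (k + 1)) : Continuous (hG x i) := by
  unfold hG; fun_prop
lemma eY_cont (i : Fin k) : Continuous (eY y i) := by
  unfold eY; fun_prop

lemma ext_gen (S : Set ℝ) (hS : S.Finite) (f h : ℝ → ℝ) (hf : Continuous f) (hh : Continuous h)
    (H : ∀ t, t ∉ S → f t = h t) (t : ℝ) : f t = h t := by
  have : f = h := Continuous.ext_on (hS.countable.dense_compl ℝ) hf hh (fun t ht => H t ht)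
  rw [this]

lemma gen_a (hL : ∀ t, ∏ i, (t - y i) = ∑ j, g j * ∏ l ∈ univ.erase j, (t - x l)) (t θ : ℝ)
    (hxi : Function.Injective x) (hyi : Function.Injective y) :
    θ * ∑ i, ∑ j ∈ univ.erase i, 1 / (x i - x j) * hX x g i t -
      1 / 2 * ∑ m, ∑ n ∈ univ.erase m,
      θ * (g m - g n) * ((x m - x n) ^ 2)⁻¹ * (hG x m t - hG x n t) =
    θ * ∑ i, ∑ j ∈ univ.erase i, 1 / (y i - y j) * eY y i t := by
  have c1 := fun i => hX_cont (x := x) (g := g) i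
  have c2 := fun i => hG_cont (x := x) i
  have c3 := fun i => eY_cont (y := y) i
  refine ext_gen (Set.range x ∪ Set.range y) ((Set.finite_range x).union (Set.finite_range y))
    (fun t => θ * ∑ i, ∑ j ∈ univ.erase i, 1 / (x i - x j) * hX x g i t -
      1 / 2 * ∑ m, ∑ n ∈ univ.erase m,
      θ * (g m - g n) * ((x m - x n) ^ 2)⁻¹ * (hG x m t - hG x n t))
    (fun t => θ * ∑ i, ∑ j ∈ univ.erase i, 1 / (y i - y j) * eY y i t) ?_ ?_ ?_ t
  · fun_prop
  · fun_prop
  · intro t ht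
    exact gen_a0 hL t θ hxi hyi (fun i h => ht (Or.inl ⟨i, (sub_eq_zero.1 h).symm⟩))
      (fun i h => ht (Or.inr ⟨i, (sub_eq_zero.1 h).symm⟩))

lemma gen_b (hL : ∀ t, ∏ i, (t - y i) = ∑ j, g j * ∏ l ∈ univ.erase j, (t - x l)) (t s : ℝ)
    (hxi : Function.Injective x) :
    ∑ i, hX x g i t * hX x g i s + ∑ m, ∑ n ∈ univ.erase m,
      g m * g n * ((x m - x n) ^ 2)⁻¹ * ((hG x m t - hG x n t) * (hG x m s - hG x n s)) =
    ∑ i, eY y i t * eY y i s := by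
  have c1 := fun i => hX_cont (x := x) (g := g) i
  have c2 := fun i => hG_cont (x := x) i
  have c3 := fun i => eY_cont (y := y) i
  have hS := (Set.finite_range x).union (Set.finite_range y)
  refine ext_gen (Set.range x ∪ Set.range y) hS
    (fun s => ∑ i, hX x g i t * hX x g i s + ∑ m, ∑ n ∈ univ.erase m,
      g m * g n * ((x m - x n) ^ 2)⁻¹ * ((hG x m t - hG x n t) * (hG x m s - hG x n s)))
    (fun s => ∑ i, eY y i t * eY y i s) (by fun_prop) (by fun_prop) ?_ s
  intro s hs
  refine ext_gen ((Set.range x ∪ Set.range y) ∪ {s}) (hS.union (Set.finite_singleton s))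
    (fun t => ∑ i, hX x g i t * hX x g i s + ∑ m, ∑ n ∈ univ.erase m,
      g m * g n * ((x m - x n) ^ 2)⁻¹ * ((hG x m t - hG x n t) * (hG x m s - hG x n s)))
    (fun t => ∑ i, eY y i t * eY y i s) (by fun_prop) (by fun_prop) ?_ t
  intro t ht
  exact gen_b0 hL t s hxi (fun h => ht (Or.inr h))
    (fun i h => ht (Or.inl (Or.inl ⟨i, (sub_eq_zero.1 h).symm⟩)))
    (fun i h => ht (Or.inl (Or.inr ⟨i, (sub_eq_zero.1 h).symm⟩)))
    (fun i h => hs (Or.inl ⟨i, (sub_eq_zero.1 h).symm⟩))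
    (fun i h => hs (Or.inr ⟨i, (sub_eq_zero.1 h).symm⟩))

end


lemma vander_mem {M : Type*} [AddCommGroup M] [Module ℝ M] (S : Submodule ℝ M) (n : ℕ)
    (c : Fin n → M) (h : ∀ t : ℝ, ∑ j : Fin n, t ^ (j : ℕ) • c j ∈ S) (j : Fin n) : c j ∈ S := by
  let v : Fin n → ℝ := fun i => (i : ℕ)
  have hv : Function.Injective v := fun a b hab => by
    apply Fin.ext; simpa [v] using hab
  have hdet : IsUnit (Matrix.vandermonde v).det :=
    isUnit_iff_ne_zero.2 (Matrix.det_vandermonde_ne_zero_iff.2 hv)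
  set V := Matrix.vandermonde v with hV
  have key : c j = ∑ i, V⁻¹ j i • ∑ l : Fin n, (v i) ^ (l : ℕ) • c l := by
    simp only [Finset.smul_sum, smul_smul]
    rw [Finset.sum_comm]
    simp only [← Finset.sum_smul]
    have : ∀ l : Fin n, ∑ i, V⁻¹ j i * v i ^ (l : ℕ) = (1 : Matrix (Fin n) (Fin n) ℝ) j l := by
      intro l
      rw [← Matrix.nonsing_inv_mul V hdet, Matrix.mul_apply]
      rfl
    simp [this, Matrix.one_apply]
  rw [key]
  exact S.sum_mem fun i _ => S.smul_mem _ (h _)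

/-- generators on the `y` side -/
noncomputable def Egen (k : ℕ) (t : ℝ) : MvPolynomial (Fin k) ℝ :=
  ∏ i, (MvPolynomial.C t - MvPolynomial.X i)

lemma esymm_mem (k r : ℕ) (hr : r ≤ k) :
    MvPolynomial.esymm (Fin k) ℝ r ∈ Algebra.adjoin ℝ (Set.range (Egen k)) := by
  set S := Subalgebra.toSubmodule (Algebra.adjoin ℝ (Set.range (Egen k))) with hS
  have h : ∀ t : ℝ, ∑ j : Fin (k + 1), t ^ (j : ℕ) • MvPolynomial.esymm (Fin k) ℝ (k - j) ∈ S := by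
    intro t
    have h1 := congrArg (Polynomial.eval (MvPolynomial.C t))
      (MvPolynomial.prod_C_add_X_eq_sum_esymm ℝ (Fin k))
    have h2 : Egen k (-t) ∈ S := Algebra.subset_adjoin ⟨-t, rfl⟩
    have h3 : ∑ j : Fin (k + 1), t ^ (j : ℕ) • MvPolynomial.esymm (Fin k) ℝ (k - j) =
        ((-1 : ℝ) ^ k) • Egen k (-t) := by
      rw [Polynomial.eval_prod, Polynomial.eval_finsetSum] at h1
      simp only [Polynomial.eval_add, Polynomial.eval_X, Polynomial.eval_C, Polynomial.eval_mul,
        Polynomial.eval_pow, Fintype.card_fin] at h1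
      have h4 : ((-1 : ℝ) ^ k) • Egen k (-t) = ∏ i : Fin k, (MvPolynomial.C t + MvPolynomial.X i) := by
        rw [Egen, MvPolynomial.smul_eq_C_mul, map_pow, map_neg, map_one]
        rw [show ((-1 : MvPolynomial (Fin k) ℝ)) ^ k = ∏ i : Fin k, (-1) by simp,
          ← Finset.prod_mul_distrib]
        refine Finset.prod_congr rfl fun i _ => ?_
        rw [map_neg]; ring
      rw [h4, h1, Fin.sum_univ_eq_sum_range
        (fun j => t ^ j • MvPolynomial.esymm (Fin k) ℝ (k - j)) (k + 1), ← Finset.sum_range_reflect]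
      refine Finset.sum_congr rfl fun j hj => ?_
      have : j ≤ k := Nat.lt_succ_iff.1 (Finset.mem_range.1 hj)
      rw [MvPolynomial.smul_eq_C_mul, map_pow]
      rw [show k + 1 - 1 - j = k - j by omega, show k - (k - j) = j by omega]
      ring
    rw [h3]
    exact S.smul_mem _ h2
  have := vander_mem S (k + 1) _ h ⟨k - r, by omega⟩
  simp only at this
  rw [show k - (k - r) = r by omega] at this
  exact this

lemma symm_gen (k : ℕ) (P : MvPolynomial (Fin k) ℝ) (hP : P.IsSymmetric) :
    ∃ Φ : MvPolynomial ℝ ℝ, MvPolynomial.aeval (Egen k) Φ = P := by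
  obtain ⟨q, hq⟩ := MvPolynomial.esymmAlgHom_fin_surjective (R := ℝ) (le_refl k) ⟨P, hP⟩
  have h1 : P = MvPolynomial.aeval (fun i : Fin k => MvPolynomial.esymm (Fin k) ℝ (i + 1)) q := by
    have := congrArg Subtype.val hq
    rw [← MvPolynomial.esymmAlgHom_apply, this]
  have h2 : P ∈ Algebra.adjoin ℝ (Set.range (Egen k)) := by
    have h3 : P ∈ Algebra.adjoin ℝ
        (Set.range (fun i : Fin k => MvPolynomial.esymm (Fin k) ℝ (i + 1))) := by
      rw [Algebra.adjoin_range_eq_range_aeval, h1]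
      exact ⟨q, rfl⟩
    refine Algebra.adjoin_le ?_ h3
    rintro _ ⟨i, rfl⟩
    exact esymm_mem k _ i.2
  rw [Algebra.adjoin_range_eq_range_aeval] at h2
  obtain ⟨Φ, h⟩ := h2
  exact ⟨Φ, h⟩

structure IsGen {A : Type*} [CommRing A] [Algebra ℝ A] (ev : A →ₐ[ℝ] ℝ) (L : A → ℝ)
    (Γ : A → A → ℝ) : Prop where
  Ladd : ∀ f g, L (f + g) = L f + L g
  LC : ∀ c, L (algebraMap ℝ A c) = 0
  Lmul : ∀ f g, L (f * g) = ev f * L g + ev g * L f + Γ f g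
  Gadd : ∀ f g h, Γ (f + g) h = Γ f h + Γ g h
  GC : ∀ c h, Γ (algebraMap ℝ A c) h = 0
  Gmul : ∀ f g h, Γ (f * g) h = ev f * Γ g h + ev g * Γ f h

section
variable {A B : Type*} [CommRing A] [Algebra ℝ A] [CommRing B] [Algebra ℝ B]

lemma IsGen.zero (ev : A →ₐ[ℝ] ℝ) : IsGen ev (fun _ => 0) (fun _ _ => 0) := by
  constructor <;> intros <;> simp

lemma IsGen.add {ev : A →ₐ[ℝ] ℝ} {L L' Γ Γ'} (h : IsGen ev L Γ) (h' : IsGen ev L' Γ') :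
    IsGen ev (fun f => L f + L' f) (fun f g => Γ f g + Γ' f g) where
  Ladd f g := by rw [h.Ladd, h'.Ladd]; ring
  LC c := by rw [h.LC, h'.LC]; ring
  Lmul f g := by rw [h.Lmul, h'.Lmul]; ring
  Gadd f g u := by rw [h.Gadd, h'.Gadd]; ring
  GC c u := by rw [h.GC, h'.GC]; ring
  Gmul f g u := by rw [h.Gmul, h'.Gmul]; ring

lemma IsGen.sum {ι : Type*} {ev : A →ₐ[ℝ] ℝ} (s : Finset ι) {L : ι → A → ℝ} {Γ : ι → A → A → ℝ}
    (h : ∀ i ∈ s, IsGen ev (L i) (Γ i)) :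
    IsGen ev (fun f => ∑ i ∈ s, L i f) (fun f g => ∑ i ∈ s, Γ i f g) := by
  classical
  induction s using Finset.induction_on with
  | empty => simpa using IsGen.zero ev
  | insert a s ha ih =>
    simp only [Finset.sum_insert ha]
    exact (h a (mem_insert_self a s)).add (ih fun i hi => h i (mem_insert_of_mem hi))

lemma IsGen.der (ev : A →ₐ[ℝ] ℝ) (D : Derivation ℝ A A) (a b : ℝ) :
    IsGen ev (fun f => a * ev (D (D f)) + b * ev (D f)) (fun f g => 2 * a * (ev (D f) * ev (D g))) where
  Ladd f g := by simp only [map_add]; ring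
  LC c := by simp
  Lmul f g := by simp only [Derivation.leibniz, map_add, smul_eq_mul, map_mul]; ring
  Gadd f g u := by simp only [map_add]; ring
  GC c u := by simp
  Gmul f g u := by simp only [Derivation.leibniz, map_add, smul_eq_mul, map_mul]; ring

lemma IsGen.transfer {τ : Type*} {evA : A →ₐ[ℝ] ℝ} {LA ΓA} (hA : IsGen evA LA ΓA)
    {evB : B →ₐ[ℝ] ℝ} {LB ΓB} (hB : IsGen evB LB ΓB) (H : τ → A) (E : τ → B)
    (h0 : ∀ t, evA (H t) = evB (E t)) (h1 : ∀ t, LA (H t) = LB (E t))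
    (h2 : ∀ t s, ΓA (H t) (H s) = ΓB (E t) (E s)) (Φ : MvPolynomial τ ℝ) :
    evA (MvPolynomial.aeval H Φ) = evB (MvPolynomial.aeval E Φ) ∧
    LA (MvPolynomial.aeval H Φ) = LB (MvPolynomial.aeval E Φ) := by
  have e : ∀ Φ : MvPolynomial τ ℝ,
      evA (MvPolynomial.aeval H Φ) = evB (MvPolynomial.aeval E Φ) := by
    intro Φ
    induction Φ using MvPolynomial.induction_on with
    | C a => simp
    | add p q hp hq => simp [hp, hq]
    | mul_X p i hp => simp [hp, h0]
  have g : ∀ (Φ : MvPolynomial τ ℝ) s,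
      ΓA (MvPolynomial.aeval H Φ) (H s) = ΓB (MvPolynomial.aeval E Φ) (E s) := by
    intro Φ s
    induction Φ using MvPolynomial.induction_on with
    | C a => rw [MvPolynomial.aeval_C, MvPolynomial.aeval_C, hA.GC, hB.GC]
    | add p q hp hq => rw [map_add, map_add, hA.Gadd, hB.Gadd, hp, hq]
    | mul_X p i hp => rw [map_mul, map_mul, hA.Gmul, hB.Gmul, hp, e, MvPolynomial.aeval_X,
        MvPolynomial.aeval_X, h2, h0]
  refine ⟨e Φ, ?_⟩
  induction Φ using MvPolynomial.induction_on with
  | C a => rw [MvPolynomial.aeval_C, MvPolynomial.aeval_C, hA.LC, hB.LC]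
  | add p q hp hq => rw [map_add, map_add, hA.Ladd, hB.Ladd, hp, hq]
  | mul_X p i hp => rw [map_mul, map_mul, hA.Lmul, hB.Lmul, hp, e, MvPolynomial.aeval_X,
      MvPolynomial.aeval_X, h1, h0, ← g p i]
end


lemma pderiv_lin_prod {τ ι : Type*} [DecidableEq ι] (f : ι → τ) (hf : Function.Injective f) (t : ℝ)
    (i : ι) (s : Finset ι) :
    MvPolynomial.pderiv (f i) (∏ l ∈ s, (MvPolynomial.C t - MvPolynomial.X (f l)) :
      MvPolynomial τ ℝ) =
    if i ∈ s then -∏ l ∈ s.erase i, (MvPolynomial.C t - MvPolynomial.X (f l)) else 0 := by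
  classical
  induction s using Finset.induction_on with
  | empty => simp
  | insert a s ha ih =>
    rw [Finset.prod_insert ha, MvPolynomial.pderiv_mul, ih, map_sub, MvPolynomial.pderiv_C]
    by_cases h : i = a
    · subst h
      simp [ha, MvPolynomial.pderiv_X_self]
    · rw [MvPolynomial.pderiv_X_of_ne (fun h' => h (hf h').symm)]
      by_cases hi : i ∈ s
      · rw [if_pos hi, if_pos (Finset.mem_insert_of_mem hi), Finset.erase_insert_of_ne (Ne.symm h),
          Finset.prod_insert (fun h' => ha (Finset.mem_of_mem_erase h'))]
        ring
      · rw [if_neg hi, if_neg (by simp [h, hi])]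
        ring

lemma pderiv_lin_prod_zero {τ ι : Type*} (f : ι → τ) (u : τ) (hu : ∀ i, f i ≠ u) (t : ℝ)
    (s : Finset ι) :
    MvPolynomial.pderiv u (∏ l ∈ s, (MvPolynomial.C t - MvPolynomial.X (f l)) :
      MvPolynomial τ ℝ) = 0 := by
  classical
  induction s using Finset.induction_on with
  | empty => simp
  | insert a s ha ih =>
    rw [Finset.prod_insert ha, MvPolynomial.pderiv_mul, ih, map_sub, MvPolynomial.pderiv_C,
      MvPolynomial.pderiv_X_of_ne (hu a)]
    simp

section
variable {k : ℕ}

lemma Egen_ev (y : Fin k → ℝ) (t : ℝ) : MvPolynomial.aeval y (Egen k t) = ∏ i, (t - y i) := by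
  simp [Egen]

lemma Egen_pd (i : Fin k) (t : ℝ) : MvPolynomial.pderiv i (Egen k t) =
    -∏ l ∈ univ.erase i, (MvPolynomial.C t - MvPolynomial.X l) := by
  have := pderiv_lin_prod (id : Fin k → Fin k) Function.injective_id t i univ
  simpa [Egen] using this

lemma Egen_pd_ev (y : Fin k → ℝ) (i : Fin k) (t : ℝ) :
    MvPolynomial.aeval y (MvPolynomial.pderiv i (Egen k t)) = eY y i t := by
  rw [Egen_pd]; simp [eY]

lemma Egen_pd2 (i : Fin k) (t : ℝ) :
    MvPolynomial.pderiv i (MvPolynomial.pderiv i (Egen k t)) = 0 := by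
  rw [Egen_pd, map_neg]
  have := pderiv_lin_prod (id : Fin k → Fin k) Function.injective_id t i (univ.erase i)
  simp only [id, Finset.mem_erase, ne_eq, not_true_eq_false, false_and, if_false] at this
  rw [this, neg_zero]

/-- generators on the `(x, g)` side -/
noncomputable def Hgen (k : ℕ) (t : ℝ) : MvPolynomial (Fin (k + 1) ⊕ Fin (k + 1)) ℝ :=
  ∑ j, MvPolynomial.X (Sum.inr j) *
    ∏ l ∈ univ.erase j, (MvPolynomial.C t - MvPolynomial.X (Sum.inl l))

lemma Hgen_ev (x g : Fin (k + 1) → ℝ) (t : ℝ) : MvPolynomial.aeval (Sum.elim x g) (Hgen k t) =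
    ∑ j, g j * ∏ l ∈ univ.erase j, (t - x l) := by
  simp [Hgen]

lemma Hgen_pdX (i : Fin (k + 1)) (t : ℝ) : MvPolynomial.pderiv (Sum.inl i) (Hgen k t) =
    -∑ j ∈ univ.erase i, MvPolynomial.X (Sum.inr j) *
      ∏ l ∈ (univ.erase j).erase i, (MvPolynomial.C t - MvPolynomial.X (Sum.inl l)) := by
  rw [Hgen, map_sum, ← Finset.sum_neg_distrib]
  simp only [MvPolynomial.pderiv_mul, pderiv_lin_prod (Sum.inl : Fin (k+1) → Fin (k+1) ⊕ Fin (k+1))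
    Sum.inl_injective, MvPolynomial.pderiv_X_of_ne (Sum.inr_ne_inl), zero_mul, zero_add]
  rw [← Finset.add_sum_erase univ _ (mem_univ i)]
  rw [if_neg (by simp), mul_zero, zero_add]
  refine Finset.sum_congr rfl fun j hj => ?_
  rw [if_pos (by simp [(Finset.mem_erase.1 hj).1.symm])]
  ring

lemma Hgen_pdX_ev (x g : Fin (k + 1) → ℝ) (i : Fin (k + 1)) (t : ℝ) :
    MvPolynomial.aeval (Sum.elim x g) (MvPolynomial.pderiv (Sum.inl i) (Hgen k t)) = hX x g i t := by
  rw [Hgen_pdX]; simp [hX]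

lemma Hgen_pdX2 (i : Fin (k + 1)) (t : ℝ) :
    MvPolynomial.pderiv (Sum.inl i) (MvPolynomial.pderiv (Sum.inl i) (Hgen k t)) = 0 := by
  rw [Hgen_pdX, map_neg, map_sum]
  simp only [MvPolynomial.pderiv_mul, pderiv_lin_prod (Sum.inl : Fin (k+1) → Fin (k+1) ⊕ Fin (k+1))
    Sum.inl_injective, MvPolynomial.pderiv_X_of_ne (Sum.inr_ne_inl), zero_mul, zero_add]
  simp

lemma Hgen_pdG (i : Fin (k + 1)) (t : ℝ) : MvPolynomial.pderiv (Sum.inr i) (Hgen k t) =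
      ∏ l ∈ univ.erase i, (MvPolynomial.C t - MvPolynomial.X (Sum.inl l)) := by
  rw [Hgen, map_sum]
  simp only [MvPolynomial.pderiv_mul,
    pderiv_lin_prod_zero (Sum.inl : Fin (k+1) → Fin (k+1) ⊕ Fin (k+1)) (Sum.inr i)
      (fun _ => Sum.inl_ne_inr), mul_zero, add_zero]
  rw [Finset.sum_eq_single i]
  · rw [MvPolynomial.pderiv_X_self, one_mul]
  · intro j _ hj
    rw [MvPolynomial.pderiv_X_of_ne (fun h => hj (Sum.inr_injective h)), zero_mul]
  · simp

lemma Hgen_pdG_ev (x g : Fin (k + 1) → ℝ) (i : Fin (k + 1)) (t : ℝ) :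
    MvPolynomial.aeval (Sum.elim x g) (MvPolynomial.pderiv (Sum.inr i) (Hgen k t)) = hG x i t := by
  rw [Hgen_pdG]; simp [hG]

lemma Hgen_pdG2 (i j : Fin (k + 1)) (t : ℝ) :
    MvPolynomial.pderiv (Sum.inr i) (MvPolynomial.pderiv (Sum.inr j) (Hgen k t)) = 0 := by
  rw [Hgen_pdG]
  exact pderiv_lin_prod_zero _ _ (fun _ => Sum.inl_ne_inr) _ _

/-- difference derivation -/
noncomputable def dlt (m n : Fin (k + 1)) :
    Derivation ℝ (MvPolynomial (Fin (k + 1) ⊕ Fin (k + 1)) ℝ)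
      (MvPolynomial (Fin (k + 1) ⊕ Fin (k + 1)) ℝ) :=
  MvPolynomial.pderiv (Sum.inr m) - MvPolynomial.pderiv (Sum.inr n)

lemma dlt_apply (m n : Fin (k + 1)) (F) : dlt m n F =
  MvPolynomial.pderiv (Sum.inr m) F - MvPolynomial.pderiv (Sum.inr n) F := rfl

noncomputable def LA (θ : ℝ) (x g : Fin (k + 1) → ℝ)
    (F : MvPolynomial (Fin (k + 1) ⊕ Fin (k + 1)) ℝ) : ℝ :=
  ∑ i, (1 / 2 * MvPolynomial.aeval (Sum.elim x g)
      (MvPolynomial.pderiv (Sum.inl i) (MvPolynomial.pderiv (Sum.inl i) F)) +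
    (θ * ∑ j ∈ univ.erase i, 1 / (x i - x j)) *
      MvPolynomial.aeval (Sum.elim x g) (MvPolynomial.pderiv (Sum.inl i) F)) +
  ∑ m, ∑ n ∈ univ.erase m, (1 / 2 * (g m * g n * ((x m - x n) ^ 2)⁻¹) *
      MvPolynomial.aeval (Sum.elim x g) (dlt m n (dlt m n F)) +
    (-(1 / 2) * (θ * (g m - g n) * ((x m - x n) ^ 2)⁻¹)) *
      MvPolynomial.aeval (Sum.elim x g) (dlt m n F))

noncomputable def LB (θ : ℝ) (y : Fin k → ℝ) (F : MvPolynomial (Fin k) ℝ) : ℝ :=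
  ∑ i, (1 / 2 * MvPolynomial.aeval y (MvPolynomial.pderiv i (MvPolynomial.pderiv i F)) +
    (θ * ∑ j ∈ univ.erase i, 1 / (y i - y j)) *
      MvPolynomial.aeval y (MvPolynomial.pderiv i F))

lemma pointwise (θ : ℝ) (x g : Fin (k + 1) → ℝ) (y : Fin k → ℝ)
    (hL : ∀ t, ∏ i, (t - y i) = ∑ j, g j * ∏ l ∈ univ.erase j, (t - x l))
    (hxi : Function.Injective x) (hyi : Function.Injective y) (Φ : MvPolynomial ℝ ℝ) :
    MvPolynomial.aeval (Sum.elim x g) (MvPolynomial.aeval (Hgen k) Φ) =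
      MvPolynomial.aeval y (MvPolynomial.aeval (Egen k) Φ) ∧
    LA θ x g (MvPolynomial.aeval (Hgen k) Φ) = LB θ y (MvPolynomial.aeval (Egen k) Φ) := by
  have hA : IsGen (MvPolynomial.aeval (Sum.elim x g)) (LA θ x g) _ :=
    (IsGen.sum univ fun i _ => IsGen.der (MvPolynomial.aeval (Sum.elim x g))
      (MvPolynomial.pderiv (Sum.inl i)) (1 / 2) (θ * ∑ j ∈ univ.erase i, 1 / (x i - x j))).add
    (IsGen.sum univ fun m _ => IsGen.sum (univ.erase m) fun n _ =>
      IsGen.der (MvPolynomial.aeval (Sum.elim x g)) (dlt m n)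
        (1 / 2 * (g m * g n * ((x m - x n) ^ 2)⁻¹))
        (-(1 / 2) * (θ * (g m - g n) * ((x m - x n) ^ 2)⁻¹)))
  have hB : IsGen (MvPolynomial.aeval y) (LB θ y) _ :=
    (IsGen.sum univ fun i _ => IsGen.der (MvPolynomial.aeval y)
      (MvPolynomial.pderiv i) (1 / 2) (θ * ∑ j ∈ univ.erase i, 1 / (y i - y j)))
  refine IsGen.transfer hA hB (Hgen k) (Egen k) ?_ ?_ ?_ Φ
  · intro t
    rw [Hgen_ev, Egen_ev, hL]
  · intro t
    have := gen_a hL t θ hxi hyi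
    simp only [LA, LB, dlt_apply, map_sub, Hgen_pdG2, Hgen_pdX2, Egen_pd2, Hgen_pdG_ev, Hgen_pdX_ev,
      Egen_pd_ev, map_zero, sub_zero, mul_zero, zero_add]
    simp only [Finset.mul_sum, Finset.sum_mul] at this ⊢
    rw [← Finset.sum_sub_distrib] at this
    simp only [← Finset.sum_sub_distrib] at this
    simp only [← Finset.sum_add_distrib]
    rw [← sub_eq_zero] at this ⊢
    rw [← this]
    congr 1
    · refine Finset.sum_congr rfl fun i _ => Finset.sum_congr rfl fun j _ => ?_
      ring
    · refine Finset.sum_congr rfl fun i _ => Finset.sum_congr rfl fun j _ => ?_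
      ring
  · intro t s
    have := gen_b hL t s hxi
    simp only [dlt_apply, map_sub, Hgen_pdG_ev, Hgen_pdX_ev, Egen_pd_ev]
    have e1 : (2 : ℝ) * (1 / 2) = 1 := by norm_num
    simp only [← mul_assoc, e1, one_mul]
    simp only [← mul_assoc] at this
    exact this

end


section
variable {k : ℕ}

noncomputable def dl (d : Fin (k + 1) ⊕ Fin (k + 1) →₀ ℕ) : Fin (k + 1) →₀ ℕ :=
  Finsupp.equivFunOnFinite.symm (fun i => d (Sum.inl i))

lemma dl_apply (d : Fin (k + 1) ⊕ Fin (k + 1) →₀ ℕ) (i) : dl d i = d (Sum.inl i) := rfl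

noncomputable def DM (k : ℕ) (θ : ℝ) : MvPolynomial (Fin (k + 1) ⊕ Fin (k + 1)) ℝ →ₗ[ℝ]
    MvPolynomial (Fin (k + 1)) ℝ :=
  (MvPolynomial.basisMonomials (Fin (k + 1) ⊕ Fin (k + 1)) ℝ).constr ℝ
    (fun d => MvPolynomial.monomial (dl d) (dmom (k + 1) θ (fun j => d (Sum.inr j))))

lemma DM_monomial (θ : ℝ) (d : Fin (k + 1) ⊕ Fin (k + 1) →₀ ℕ) (c : ℝ) :
    DM k θ (MvPolynomial.monomial d c) =
      MvPolynomial.monomial (dl d) (c * dmom (k + 1) θ (fun j => d (Sum.inr j))) := by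
  have h : MvPolynomial.monomial d c = c • MvPolynomial.basisMonomials
      (Fin (k + 1) ⊕ Fin (k + 1)) ℝ d := by
    rw [MvPolynomial.coe_basisMonomials, MvPolynomial.smul_monomial]; simp
  rw [h, map_smul, DM, Module.Basis.constr_basis, MvPolynomial.smul_monomial, smul_eq_mul]

lemma DM_pderiv (θ : ℝ) (i : Fin (k + 1)) (F : MvPolynomial (Fin (k + 1) ⊕ Fin (k + 1)) ℝ) :
    MvPolynomial.pderiv i (DM k θ F) = DM k θ (MvPolynomial.pderiv (Sum.inl i) F) := by
  induction F using MvPolynomial.induction_on' with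
  | monomial d c =>
    rw [DM_monomial, MvPolynomial.pderiv_monomial, MvPolynomial.pderiv_monomial, DM_monomial]
    congr 1
    · congr 1
      · ext j
        simp [dl_apply, Finsupp.single_apply]
    · simp [dl_apply]
      ring
  | add p q hp hq => simp only [map_add, hp, hq]

lemma DM_ibp {θ : ℝ} (hθ : 0 < θ) (m n : Fin (k + 1)) (hmn : m ≠ n)
    (F : MvPolynomial (Fin (k + 1) ⊕ Fin (k + 1)) ℝ) :
    DM k θ (MvPolynomial.X (Sum.inr m) * MvPolynomial.X (Sum.inr n) * dlt m n F) =
    θ • DM k θ ((MvPolynomial.X (Sum.inr m) - MvPolynomial.X (Sum.inr n)) * F) := by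
  induction F using MvPolynomial.induction_on' with
  | add p q hp hq => simp only [map_add, mul_add, hp, hq, smul_add]
  | monomial d c =>
    have h1 : MvPolynomial.X (Sum.inr m) * MvPolynomial.X (Sum.inr n) *
        dlt m n (MvPolynomial.monomial d c) =
        (d (Sum.inr m) : ℝ) • (MvPolynomial.X (Sum.inr n) * MvPolynomial.monomial d c) -
        (d (Sum.inr n) : ℝ) • (MvPolynomial.X (Sum.inr m) * MvPolynomial.monomial d c) := by
      have a1 := MvPolynomial.X_mul_pderiv_monomial (i := Sum.inr m) (m := d) (r := c)
      have a2 := MvPolynomial.X_mul_pderiv_monomial (i := Sum.inr n) (m := d) (r := c)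
      rw [← Nat.cast_smul_eq_nsmul ℝ, MvPolynomial.smul_eq_C_mul] at a1 a2
      rw [dlt_apply, MvPolynomial.smul_eq_C_mul, MvPolynomial.smul_eq_C_mul]
      linear_combination MvPolynomial.X (Sum.inr n) * a1 - MvPolynomial.X (Sum.inr m) * a2
    have hX : ∀ j, DM k θ (MvPolynomial.X (Sum.inr j) * MvPolynomial.monomial d c) *
        MvPolynomial.C (∑ j, (θ + d (Sum.inr j))) =
        MvPolynomial.C (c * dmom (k + 1) θ (fun j => d (Sum.inr j)) * (θ + d (Sum.inr j))) *
          MvPolynomial.monomial (dl d) 1 := by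
      intro j
      rw [MvPolynomial.X, MvPolynomial.monomial_mul, DM_monomial, one_mul, mul_comm _ (MvPolynomial.C _),
        MvPolynomial.C_mul_monomial, MvPolynomial.C_mul_monomial, mul_one]
      have := dmom_succ hθ (fun j => d (Sum.inr j))
        (fun l => ((Finsupp.single (Sum.inr j) 1 + d : Fin (k + 1) ⊕ Fin (k + 1) →₀ ℕ)) (Sum.inr l)) j
        (by simp [add_comm]) (by
          intro l hl
          simp [Finsupp.single_apply, hl.symm])
      congr 1
      · congr 1
        ext i
        simp [dl_apply]
      · linear_combination c * this
    have hS : 0 < ∑ j : Fin (k + 1), (θ + d (Sum.inr j)) :=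
      Finset.sum_pos (fun j _ => by positivity) univ_nonempty
    have hS' : MvPolynomial.C (σ := Fin (k + 1)) (∑ j : Fin (k + 1), (θ + d (Sum.inr j))) ≠ 0 := by
      rw [Ne, MvPolynomial.C_eq_zero]; exact hS.ne'
    refine mul_right_cancel₀ hS' ?_
    rw [h1, map_sub, map_smul, map_smul, sub_mul (MvPolynomial.X (Sum.inr m)), map_sub]
    simp only [MvPolynomial.smul_eq_C_mul]
    have e1 := hX m
    have e2 := hX n
    simp only [map_mul, map_add] at e1 e2
    linear_combination (MvPolynomial.C (d (Sum.inr m) : ℝ) + MvPolynomial.C θ) * e2 -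
      (MvPolynomial.C (d (Sum.inr n) : ℝ) + MvPolynomial.C θ) * e1

lemma dmom_perm {n : ℕ} (θ : ℝ) (a : Fin n → ℕ) (e : Equiv.Perm (Fin n)) :
    dmom n θ (fun j => a (e j)) = dmom n θ a := by
  unfold dmom
  rw [Equiv.sum_comp e (fun j => θ + (a j : ℝ)),
    Equiv.prod_comp e (fun j => Real.Gamma (θ + a j) / Real.Gamma θ)]

lemma DM_rename (θ : ℝ) (e : Equiv.Perm (Fin (k + 1)))
    (F : MvPolynomial (Fin (k + 1) ⊕ Fin (k + 1)) ℝ) :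
    MvPolynomial.rename e (DM k θ F) =
      DM k θ (MvPolynomial.rename (Equiv.sumCongr e e) F) := by
  induction F using MvPolynomial.induction_on' with
  | monomial d c =>
    rw [DM_monomial, MvPolynomial.rename_monomial, MvPolynomial.rename_monomial, DM_monomial]
    congr 1
    · congr 1
      ext i
      obtain ⟨i, rfl⟩ := e.surjective i
      rw [dl_apply, Finsupp.mapDomain_apply e.injective,
        show (Sum.inl (e i) : Fin (k + 1) ⊕ Fin (k + 1)) = Equiv.sumCongr e e (Sum.inl i) from rfl,
        Finsupp.mapDomain_apply (Equiv.injective _), dl_apply]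
    · congr 1
      rw [← dmom_perm θ (fun j => (Finsupp.mapDomain (⇑(Equiv.sumCongr e e)) d) (Sum.inr j)) e]
      congr 1
      ext j
      rw [show (Sum.inr (e j) : Fin (k + 1) ⊕ Fin (k + 1)) = Equiv.sumCongr e e (Sum.inr j) from rfl,
        Finsupp.mapDomain_apply (Equiv.injective _)]
  | add p q hp hq => simp only [map_add, hp, hq]

lemma Hgen_rename (e : Equiv.Perm (Fin (k + 1))) (t : ℝ) :
    MvPolynomial.rename (Equiv.sumCongr e e) (Hgen k t) = Hgen k t := by
  simp only [Hgen, map_sum, map_mul, map_prod, map_sub, MvPolynomial.rename_X,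
    MvPolynomial.rename_C, Equiv.sumCongr_apply, Sum.map_inl, Sum.map_inr]
  rw [← Equiv.sum_comp e (fun j => MvPolynomial.X (Sum.inr j) *
    ∏ l ∈ univ.erase j, (MvPolynomial.C t - MvPolynomial.X (Sum.inl l)))]
  refine Finset.sum_congr rfl fun j _ => ?_
  congr 1
  refine Finset.prod_bij (fun l _ => e l) ?_ ?_ ?_ ?_
  · intro l hl; simpa using hl
  · intro a _ b _ h; exact e.injective h
  · intro b hb
    exact ⟨e.symm b, by
      simp only [Finset.mem_erase, mem_univ, and_true, ne_eq] at hb ⊢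
      intro h; apply hb; rw [← h]; simp, by simp⟩
  · intros; rfl

lemma DM_symm (θ : ℝ) (Φ : MvPolynomial ℝ ℝ) :
    (DM k θ (MvPolynomial.aeval (Hgen k) Φ)).IsSymmetric := by
  intro e
  rw [DM_rename]
  congr 1
  rw [← AlgHom.comp_apply, MvPolynomial.comp_aeval]
  congr 2
  ext t
  rw [Hgen_rename]

lemma aeval_mon (x g : Fin (k + 1) → ℝ) (d : Fin (k + 1) ⊕ Fin (k + 1) →₀ ℕ) (c : ℝ) :
    MvPolynomial.aeval (Sum.elim x g) (MvPolynomial.monomial d c) =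
      (c * ∏ i, x i ^ d (Sum.inl i)) * ∏ j, g j ^ d (Sum.inr j) := by
  rw [MvPolynomial.aeval_monomial, Finsupp.prod_fintype _ _ (by simp), Fintype.prod_sum_type]
  simp [mul_assoc]

lemma DM_eval {β : ℝ} (hβ : 0 < β) {x : Fin (k + 1) → ℝ} (hx : StrictMono x)
    (F : MvPolynomial (Fin (k + 1) ⊕ Fin (k + 1)) ℝ) :
    IntegrableOn (fun y => DAdensity k β x y * MvPolynomial.aeval (Sum.elim x (daw x y)) F)
      (DAint k x) ∧
    ∫ y in DAint k x, DAdensity k β x y * MvPolynomial.aeval (Sum.elim x (daw x y)) F =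
      MvPolynomial.eval x (DM k (β / 2) F) := by
  induction F using MvPolynomial.induction_on' with
  | monomial d c =>
    have e : (fun y => DAdensity k β x y *
        MvPolynomial.aeval (Sum.elim x (daw x y)) (MvPolynomial.monomial d c)) =
        fun y => (c * ∏ i, x i ^ d (Sum.inl i)) *
          (DAdensity k β x y * ∏ j, daw x y j ^ d (Sum.inr j)) := by
      ext y
      rw [aeval_mon]; ring
    rw [e]
    refine ⟨(da_moment_integrable hβ hx _).const_mul _, ?_⟩
    rw [integral_const_mul, da_moment hβ hx, DM_monomial, MvPolynomial.eval_monomial,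
      Finsupp.prod_fintype _ _ (by simp)]
    simp only [dl_apply]
    ring
  | add p q hp hq =>
    simp only [map_add, mul_add]
    refine ⟨hp.1.add hq.1, ?_⟩
    rw [integral_add hp.1 hq.1, hp.2, hq.2]

lemma pd_eval {m : ℕ} (p : MvPolynomial (Fin m) ℝ) (z : Fin m → ℝ) :
    DifferentiableAt ℝ (fun z => MvPolynomial.eval z p) z ∧ ∀ i,
    pd (fun z => MvPolynomial.eval z p) i z = MvPolynomial.eval z (MvPolynomial.pderiv i p) := by
  induction p using MvPolynomial.induction_on with
  | C a => simp [pd]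
  | add p q hp hq =>
    simp only [map_add]
    refine ⟨hp.1.fun_add hq.1, fun i => ?_⟩
    rw [← hp.2, ← hq.2, pd, fderiv_fun_add hp.1 hq.1]
    rfl
  | mul_X p j hp =>
    have hd : DifferentiableAt ℝ (fun z : Fin m → ℝ => z j) z := by fun_prop
    simp only [map_mul, MvPolynomial.eval_X]
    refine ⟨hp.1.fun_mul hd, fun i => ?_⟩
    have h2 : fderiv ℝ (fun z : Fin m → ℝ => z j) z (Pi.single i 1) = (Pi.single i 1 : Fin m → ℝ) j := by
      have : HasFDerivAt (fun z : Fin m → ℝ => z j)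
        (ContinuousLinearMap.proj (R := ℝ) (φ := fun _ : Fin m => ℝ) j) z := hasFDerivAt_apply j z
      rw [this.fderiv]; rfl
    rw [pd, fderiv_fun_mul hp.1 hd, MvPolynomial.pderiv_mul, map_add, map_mul, map_mul, ← hp.2]
    have h3 : MvPolynomial.eval z (MvPolynomial.pderiv i (MvPolynomial.X j)) =
        (Pi.single i 1 : Fin m → ℝ) j := by
      rw [MvPolynomial.pderiv_X]
      by_cases h : j = i
      · subst h; simp
      · simp [h]
    rw [h3, MvPolynomial.eval_X]
    simp only [_root_.add_apply, _root_.smul_apply, smul_eq_mul, h2, pd]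
    ring

lemma genA_eval {m : ℕ} (θ : ℝ) (p : MvPolynomial (Fin m) ℝ) (z : Fin m → ℝ) :
    genA θ (fun z => MvPolynomial.eval z p) z = LB θ z p := by
  have h2 : ∀ i, pd2 (fun z => MvPolynomial.eval z p) i z =
      MvPolynomial.eval z (MvPolynomial.pderiv i (MvPolynomial.pderiv i p)) := by
    intro i
    rw [← (pd_eval _ z).2 i]
    unfold pd2
    have : (fun w => fderiv ℝ (fun z => MvPolynomial.eval z p) w (Pi.single i 1)) =
        fun w => MvPolynomial.eval w (MvPolynomial.pderiv i p) := by
      ext w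
      exact (pd_eval p w).2 i
    rw [this]
    rfl
  have ha : ∀ p : MvPolynomial (Fin m) ℝ, MvPolynomial.aeval z p = MvPolynomial.eval z p := by
    intro p
    rw [← MvPolynomial.coe_aeval_eq_eval]; rfl
  unfold genA LB
  simp only [h2, (pd_eval p z).2, ha]
  rw [Finset.mul_sum, Finset.mul_sum, ← Finset.sum_add_distrib]
  refine Finset.sum_congr rfl fun i _ => ?_
  rw [← Finset.sum_mul]
  ring

end


section
variable {k : ℕ}

lemma int_LA {β : ℝ} (hβ : 0 < β) {x : Fin (k + 1) → ℝ} (hx : StrictMono x)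
    (F : MvPolynomial (Fin (k + 1) ⊕ Fin (k + 1)) ℝ) :
    ∫ y in DAint k x, DAdensity k β x y * LA (β / 2) x (daw x y) F =
      LB (β / 2) x (DM k (β / 2) F) := by
  have hθ : 0 < β / 2 := by positivity
  set θ := β / 2 with hθd
  let W : MvPolynomial (Fin (k + 1) ⊕ Fin (k + 1)) ℝ :=
    ∑ i, ((1 / 2 : ℝ) • (MvPolynomial.pderiv (Sum.inl i) (MvPolynomial.pderiv (Sum.inl i) F)) +
      (θ * ∑ j ∈ univ.erase i, 1 / (x i - x j)) • MvPolynomial.pderiv (Sum.inl i) F) +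
    ∑ m, ∑ n ∈ univ.erase m, ((1 / 2 * ((x m - x n) ^ 2)⁻¹) •
      (MvPolynomial.X (Sum.inr m) * MvPolynomial.X (Sum.inr n) * dlt m n (dlt m n F)) +
      (-(1 / 2) * (θ * ((x m - x n) ^ 2)⁻¹)) •
      ((MvPolynomial.X (Sum.inr m) - MvPolynomial.X (Sum.inr n)) * dlt m n F))
  have h1 : ∀ g, LA θ x g F = MvPolynomial.aeval (Sum.elim x g) W := by
    intro g
    simp only [LA, W, map_add, map_sum, map_smul, map_mul, map_sub, MvPolynomial.aeval_X,
      Sum.elim_inr, smul_eq_mul]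
    congr 1
    refine Finset.sum_congr rfl fun m _ => Finset.sum_congr rfl fun n _ => ?_
    ring
  simp only [h1]
  rw [(DM_eval hβ hx W).2]
  have ha : ∀ p : MvPolynomial (Fin (k + 1)) ℝ, MvPolynomial.aeval x p = MvPolynomial.eval x p := by
    intro p
    rw [← MvPolynomial.coe_aeval_eq_eval]; rfl
  simp only [W, LB, map_add, map_sum, map_smul, ← hθd, DM_pderiv, ha, MvPolynomial.smul_eval]
  rw [add_eq_left]
  refine Finset.sum_eq_zero fun m _ => Finset.sum_eq_zero fun n hn => ?_
  rw [DM_ibp hθ m n (Finset.mem_erase.1 hn).1.symm, MvPolynomial.smul_eval]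
  ring

lemma da_hL {x : Fin (k + 1) → ℝ} (hx : Function.Injective x) (y : Fin k → ℝ) (t : ℝ) :
    ∏ i, (t - y i) = ∑ j, daw x y j * ∏ l ∈ univ.erase j, (t - x l) := by
  rw [da_lagr_eval x hx]
  refine Finset.sum_congr rfl fun j _ => ?_
  have hE : univ.erase j = univ.map (Fin.succAboveEmb j) := by
    ext l
    simp only [Finset.mem_erase, mem_univ, and_true, Finset.mem_map, true_and, Fin.succAboveEmb_apply]
    constructor
    · intro h
      exact Fin.exists_succAbove_eq h
    · rintro ⟨i, rfl⟩
      exact Fin.succAbove_ne j i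
  rw [hE, Finset.prod_map]
  rfl
end

/-- Intertwining of the Dyson Brownian motion generators `A^{(k)}` and `A^{(k+1)}` by the
Dixon–Anderson kernel on symmetric polynomials: for any symmetric polynomial `p` in `k`
variables there is a symmetric polynomial `q` in `k+1` variables with
`q(x) = ∫_{W^{(k)}(x)} Λ^{(k)}(x,y) p(y) dy` and
`(A^{(k+1)}q)(x) = ∫_{W^{(k)}(x)} Λ^{(k)}(x,y) (A^{(k)}p)(y) dy`
for all strictly increasing `x ∈ ℝ^{k+1}`. -/
theorem DA_intertwines_generators (β : ℝ) (hβ : 0 < β) (k : ℕ) (hk : 1 ≤ k)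
    (P : MvPolynomial (Fin k) ℝ) (hP : P.IsSymmetric) :
    ∃ Q : MvPolynomial (Fin (k + 1)) ℝ, Q.IsSymmetric ∧
      (∀ x : Fin (k + 1) → ℝ, StrictMono x →
        MvPolynomial.eval x Q =
          ∫ y in DAdomain k x, DAdensity k β x y * MvPolynomial.eval y P) ∧
      (∀ x : Fin (k + 1) → ℝ, StrictMono x →
        genA (β / 2) (fun z => MvPolynomial.eval z Q) x =
          ∫ y in DAdomain k x,
            DAdensity k β x y * genA (β / 2) (fun z => MvPolynomial.eval z P) y) := by
  obtain ⟨Φ, rfl⟩ := symm_gen k P hP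
  refine ⟨DM k (β / 2) (MvPolynomial.aeval (Hgen k) Φ), DM_symm _ _, ?_, ?_⟩
  · intro x hx
    rw [← (DM_eval hβ hx _).2, ← setIntegral_congr_set (DA_ae x)]
    refine setIntegral_congr_fun (DAint_meas x) fun y hy => ?_
    have := (pointwise (β / 2) x (daw x y) y (da_hL hx.injective y) hx.injective
      (da_y_strict hx hy).injective Φ).1
    simp only [this]
    rw [← MvPolynomial.coe_aeval_eq_eval]; rfl
  · intro x hx
    simp only [genA_eval]
    rw [← int_LA hβ hx, ← setIntegral_congr_set (DA_ae x)]
    refine setIntegral_congr_fun (DAint_meas x) fun y hy => ?_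
    have := (pointwise (β / 2) x (daw x y) y (da_hL hx.injective y) hx.injective
      (da_y_strict hx hy).injective Φ).2
    simp only [this]
end
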